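/- Let x and y be normal infinite words over the same finite alphabet A (|A| ≥ 2). Then x and y are finite-state independent if and only if for every shuffler S over A, the output S(x,y) is normal. -/

import Mathlib

open Filter Topology

namespace FSI

variable {A B D Q : Type*}

/-- The prefix of length `n` of the infinite word `x`. -/
def pref (x : ℕ → A) (n : ℕ) : List A := (List.range n).map x

/-- Number of (possibly overlapping) occurrences of `u` in `w`. -/
noncomputable def occ (w u : List A) : ℕ :=
  Nat.card {i : ℕ | i + u.length ≤ w.length ∧ (w.drop i).take u.length = u}

/-- Number of aligned occurrences of `u` in `w`. -/
noncomputable def alocc (w u : List A) : ℕ :=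
  Nat.card {i : ℕ | i + u.length ≤ w.length ∧ i % u.length = 0 ∧ (w.drop i).take u.length = u}

/-- `x` is simply normal to word length `ℓ`. -/
def SimplyNormalTo [Fintype A] (x : ℕ → A) (ℓ : ℕ) : Prop :=
  ∀ u : List A, u.length = ℓ →
    Tendsto (fun n : ℕ => (alocc (pref x (n * ℓ)) u : ℝ) / n) atTop
      (nhds ((Fintype.card A : ℝ)⁻¹ ^ ℓ))

/-- `x` is a normal infinite word. -/
def Normal [Fintype A] (x : ℕ → A) : Prop := ∀ ℓ : ℕ, 1 ≤ ℓ → SimplyNormalTo x ℓ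

/-! ### Two-tape automata -/

/-- A `2`-automaton with input alphabets `A`, `B` and state set `Q`;
`none` plays the role of the empty word `ε` in transition labels. -/
structure TwoAut (A B Q : Type*) where
  init : Set Q
  trans : Set (Q × (Option A × Option B) × Q)

/-- The support of a label. -/
def lsupp (l : Option A × Option B) : Bool × Bool := (l.1.isSome, l.2.isSome)

/-- A `2`-deterministic `2`-automaton. -/
def TwoAut.TwoDet (M : TwoAut A B Q) : Prop :=
  (∃ q₀, M.init = {q₀}) ∧
  ∀ t ∈ M.trans, ∀ t' ∈ M.trans, t.1 = t'.1 →
    lsupp t.2.1 = lsupp t'.2.1 ∧ (t.2.1 = t'.2.1 → t = t')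

/-- A `1`-deterministic `2`-automaton. -/
def TwoAut.OneDet (M : TwoAut A B Q) : Prop :=
  (∃ q₀, M.init = {q₀}) ∧
  ∀ t ∈ M.trans, ∀ t' ∈ M.trans, t.1 = t'.1 →
    t.2.1.1.isSome = t'.2.1.1.isSome ∧ (t.2.1.1 = t'.2.1.1 → t = t')

/-- `2`-completeness. -/
def TwoAut.TwoComplete (M : TwoAut A B Q) : Prop :=
  ∀ (q : Q) (l l' : Option A × Option B),
    (∃ q', (q, l, q') ∈ M.trans) → lsupp l' = lsupp l → ∃ q', (q, l', q') ∈ M.trans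

/-- Every transition reads exactly one symbol. -/
def TwoAut.OneSymbol (M : TwoAut A B Q) : Prop :=
  ∀ t ∈ M.trans, lsupp t.2.1 = (true, false) ∨ lsupp t.2.1 = (false, true)

def TwoAut.Step (M : TwoAut A B Q) (p q : Q) : Prop := ∃ l, (p, l, q) ∈ M.trans

/-- There is a finite run from `p` to `q`. -/
def TwoAut.Reaches (M : TwoAut A B Q) : Q → Q → Prop := Relation.ReflTransGen M.Step

def TwoAut.StronglyConnected (M : TwoAut A B Q) : Prop := ∀ p q, M.Reaches p q

/-- Word read on the first tape by the first `n` transitions of `γ`. -/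
def in1 (γ : ℕ → Q × (Option A × Option B) × Q) (n : ℕ) : List A :=
  ((List.range n).map fun i => (γ i).2.1.1).reduceOption

/-- Word read on the second tape by the first `n` transitions of `γ`. -/
def in2 (γ : ℕ → Q × (Option A × Option B) × Q) (n : ℕ) : List B :=
  ((List.range n).map fun i => (γ i).2.1.2).reduceOption

/-- `γ` is an infinite run of `M` (not necessarily from the initial state) whose
two input labels are the infinite words `x` and `y`. -/
def TwoAut.IsRunOn (M : TwoAut A B Q) (γ : ℕ → Q × (Option A × Option B) × Q)
    (x : ℕ → A) (y : ℕ → B) : Prop :=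
  (∀ n, γ n ∈ M.trans) ∧ (∀ n, (γ n).2.2 = (γ (n + 1)).1) ∧
  (∀ n, in1 γ n = pref x (in1 γ n).length) ∧ (∀ n, in2 γ n = pref y (in2 γ n).length) ∧
  Tendsto (fun n => (in1 γ n).length) atTop atTop ∧
  Tendsto (fun n => (in2 γ n).length) atTop atTop

/-- The pair `(x, y)` is accepted by `M`. -/
def TwoAut.Accepts (M : TwoAut A B Q) (x : ℕ → A) (y : ℕ → B) : Prop :=
  ∃ γ, (γ 0).1 ∈ M.init ∧ M.IsRunOn γ x y

/-- Number of occurrences of the state `q` among the first `n` transitions of `γ`. -/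
noncomputable def stateCount (γ : ℕ → Q × (Option A × Option B) × Q) (q : Q) (n : ℕ) : ℕ :=
  Nat.card {i : ℕ | i < n ∧ (γ i).1 = q}

/-- Number of occurrences of the transition `τ` among the first `n` transitions of `γ`. -/
noncomputable def transCount (γ : ℕ → Q × (Option A × Option B) × Q)
    (τ : Q × (Option A × Option B) × Q) (n : ℕ) : ℕ :=
  Nat.card {i : ℕ | i < n ∧ γ i = τ}

/-! ### Markov chain associated with a one-symbol automaton -/

/-- The `(p,q)` entry of the Markov matrix associated with the transition set `T`. -/
noncomputable def markovOf {S : Type*} [Fintype A] [Fintype B]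
    (T : Set (S × (Option A × Option B) × S)) (p q : S) : ℝ :=
  (Nat.card {a : A | (p, (some a, none), q) ∈ T} : ℝ) / (Fintype.card A : ℝ) +
  (Nat.card {b : B | (p, (none, some b), q) ∈ T} : ℝ) / (Fintype.card B : ℝ)

/-- `π` is a stationary distribution for the transition set `T` restricted to the
finite state set `st`. -/
def IsStationaryOn {S : Type*} [Fintype A] [Fintype B]
    (T : Set (S × (Option A × Option B) × S)) (st : Finset S) (π : S → ℝ) : Prop :=
  (∀ s ∈ st, 0 ≤ π s) ∧ (∑ s ∈ st, π s = 1) ∧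
  ∀ q ∈ st, (∑ p ∈ st, π p * markovOf T p q) = π q

/-- `π` is a stationary distribution of the Markov chain associated with `M`. -/
def TwoAut.IsStationary [Fintype A] [Fintype B] [Fintype Q]
    (M : TwoAut A B Q) (π : Q → ℝ) : Prop :=
  IsStationaryOn M.trans Finset.univ π

/-- The frequency property for the pair `(x, y)`: in every strongly connected
`2`-deterministic `2`-automaton (reading one symbol per transition), every infinite run
on a suffix of `x` and a suffix of `y` visits each state with frequency given by the
stationary distribution, and the automaton is `2`-complete. -/
def FreqProp [Fintype A] [Fintype B] (x : ℕ → A) (y : ℕ → B) : Prop :=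
  ∀ (Q' : Type) [Fintype Q'] (M : TwoAut A B Q'), M.TwoDet → M.OneSymbol →
    M.StronglyConnected →
    ∀ (i j : ℕ) (γ : ℕ → Q' × (Option A × Option B) × Q'),
      M.IsRunOn γ (fun n => x (n + i)) (fun n => y (n + j)) →
      M.TwoComplete ∧
      ∃ π : Q' → ℝ, M.IsStationary π ∧
        ∀ q, Tendsto (fun n : ℕ => (stateCount γ q n : ℝ) / n) atTop (nhds (π q))

/-! ### Conditional compressors (2-deterministic 3-automata) -/

/-- A `3`-automaton with two input tapes (alphabets `A` and `B`) and one
output tape (alphabet `D`), with a single initial state. -/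
structure Comp3 (A B D Q : Type*) where
  init : Q
  trans : Set (Q × (Option A × Option B) × List D × Q)

/-- `2`-determinism for `3`-automata. -/
def Comp3.TwoDet (C : Comp3 A B D Q) : Prop :=
  ∀ t ∈ C.trans, ∀ t' ∈ C.trans, t.1 = t'.1 →
    lsupp t.2.1 = lsupp t'.2.1 ∧ (t.2.1 = t'.2.1 → t = t')

def c3in1 (γ : ℕ → Q × (Option A × Option B) × List D × Q) (n : ℕ) : List A :=
  ((List.range n).map fun i => (γ i).2.1.1).reduceOption

def c3in2 (γ : ℕ → Q × (Option A × Option B) × List D × Q) (n : ℕ) : List B :=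
  ((List.range n).map fun i => (γ i).2.1.2).reduceOption

def c3out (γ : ℕ → Q × (Option A × Option B) × List D × Q) (n : ℕ) : List D :=
  ((List.range n).map fun i => (γ i).2.2.1).flatten

/-- `γ` is the accepting run of `C` on the pair `(x, y)`. -/
def Comp3.IsAccRunOn (C : Comp3 A B D Q) (γ : ℕ → Q × (Option A × Option B) × List D × Q)
    (x : ℕ → A) (y : ℕ → B) : Prop :=
  (γ 0).1 = C.init ∧ (∀ n, γ n ∈ C.trans) ∧ (∀ n, (γ n).2.2.2 = (γ (n + 1)).1) ∧
  (∀ n, c3in1 γ n = pref x (c3in1 γ n).length) ∧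
  (∀ n, c3in2 γ n = pref y (c3in2 γ n).length) ∧
  Tendsto (fun n => (c3in1 γ n).length) atTop atTop ∧
  Tendsto (fun n => (c3in2 γ n).length) atTop atTop ∧
  Tendsto (fun n => (c3out γ n).length) atTop atTop

/-- For every fixed second input `y`, the input-output map `x ↦ C(x,y)` is one-to-one. -/
def Comp3.OneToOne (C : Comp3 A B D Q) : Prop :=
  ∀ (x x' : ℕ → A) (y : ℕ → B) γ γ', C.IsAccRunOn γ x y → C.IsAccRunOn γ' x' y →
    (∀ n, ∃ m, c3out γ n <+: c3out γ' m) → (∀ n, ∃ m, c3out γ' n <+: c3out γ m) →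
    x = x'

/-- The conditional compression ratio `ρ(x/y)`: the infimum, over all conditional
compressors, of the compression ratio of `x` given the oracle `y`. -/
noncomputable def condRho [Fintype A] [Fintype B] (x : ℕ → A) (y : ℕ → B) : ℝ :=
  sInf {r : ℝ | ∃ (m d : ℕ), 2 ≤ d ∧ ∃ C : Comp3 A B (Fin d) (Fin m),
    C.TwoDet ∧ C.OneToOne ∧ ∃ γ, C.IsAccRunOn γ x y ∧
      r = Filter.liminf (fun n : ℕ =>
        (((c3out γ n).length : ℝ) * Real.log d) /
        (((c3in1 γ n).length : ℝ) * Real.log (Fintype.card A))) atTop}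

/-! ### Compressors (one-to-one 1-deterministic 2-automata) -/

/-- A `2`-automaton with one input tape (alphabet `A`) and one output tape
(alphabet `D`), with a single initial state. -/
structure Comp2 (A D Q : Type*) where
  init : Q
  trans : Set (Q × Option A × List D × Q)

def Comp2.OneDet (C : Comp2 A D Q) : Prop :=
  ∀ t ∈ C.trans, ∀ t' ∈ C.trans, t.1 = t'.1 →
    t.2.1.isSome = t'.2.1.isSome ∧ (t.2.1 = t'.2.1 → t = t')

def c2in (γ : ℕ → Q × Option A × List D × Q) (n : ℕ) : List A :=
  ((List.range n).map fun i => (γ i).2.1).reduceOption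

def c2out (γ : ℕ → Q × Option A × List D × Q) (n : ℕ) : List D :=
  ((List.range n).map fun i => (γ i).2.2.1).flatten

def Comp2.IsAccRunOn (C : Comp2 A D Q) (γ : ℕ → Q × Option A × List D × Q)
    (x : ℕ → A) : Prop :=
  (γ 0).1 = C.init ∧ (∀ n, γ n ∈ C.trans) ∧ (∀ n, (γ n).2.2.2 = (γ (n + 1)).1) ∧
  (∀ n, c2in γ n = pref x (c2in γ n).length) ∧
  Tendsto (fun n => (c2in γ n).length) atTop atTop ∧
  Tendsto (fun n => (c2out γ n).length) atTop atTop

def Comp2.OneToOne (C : Comp2 A D Q) : Prop :=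
  ∀ (x x' : ℕ → A) γ γ', C.IsAccRunOn γ x → C.IsAccRunOn γ' x' →
    (∀ n, ∃ m, c2out γ n <+: c2out γ' m) → (∀ n, ∃ m, c2out γ' n <+: c2out γ m) →
    x = x'

/-- The compression ratio `ρ(x)`. -/
noncomputable def rho [Fintype A] (x : ℕ → A) : ℝ :=
  sInf {r : ℝ | ∃ (m d : ℕ), 2 ≤ d ∧ ∃ C : Comp2 A (Fin d) (Fin m),
    C.OneDet ∧ C.OneToOne ∧ ∃ γ, C.IsAccRunOn γ x ∧
      r = Filter.liminf (fun n : ℕ =>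
        (((c2out γ n).length : ℝ) * Real.log d) /
        (((c2in γ n).length : ℝ) * Real.log (Fintype.card A))) atTop}

/-- Finite-state independence. -/
def FSIndep [Fintype A] [Fintype B] (x : ℕ → A) (y : ℕ → B) : Prop :=
  condRho x y = rho x ∧ condRho y x = rho y ∧ 0 < rho x ∧ 0 < rho y

/-! ### Oblivious selectors with two input tapes -/

/-- Types of states of a selector. -/
inductive SelTy | I | II | III

/-- An oblivious selector with first input alphabet `A` and second input alphabet `B`:
at a state of type I it reads the next symbol of the first input and selects it, at a
state of type II it reads the next symbol of the first input without selecting it, and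
at a state of type III it reads the next symbol of the second input. -/
structure Sel2 (A B : Type*) where
  states : ℕ
  init : Fin states
  ty : Fin states → SelTy
  δa : Fin states → A → Fin states
  δb : Fin states → B → Fin states

/-- Configuration (current state, symbols read from `x`, symbols read from `y`)
after `n` steps. -/
def Sel2.cfg (S : Sel2 A B) (x : ℕ → A) (y : ℕ → B) : ℕ → Fin S.states × ℕ × ℕ
  | 0 => (S.init, 0, 0)
  | n + 1 =>
    let c := S.cfg x y n
    match S.ty c.1 with
    | SelTy.I => (S.δa c.1 (x c.2.1), c.2.1 + 1, c.2.2)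
    | SelTy.II => (S.δa c.1 (x c.2.1), c.2.1 + 1, c.2.2)
    | SelTy.III => (S.δb c.1 (y c.2.2), c.2.1, c.2.2 + 1)

/-- The word selected from `x` during the first `n` steps. -/
def Sel2.outList (S : Sel2 A B) (x : ℕ → A) (y : ℕ → B) (n : ℕ) : List A :=
  (List.range n).filterMap fun i =>
    let c := S.cfg x y i
    match S.ty c.1 with
    | SelTy.I => some (x c.2.1)
    | SelTy.II => none
    | SelTy.III => none

/-! ### Oblivious one-input selection automata -/

/-- An oblivious selection automaton with a single input tape. -/
structure Sel1 (B : Type*) where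
  states : ℕ
  init : Fin states
  sel : Fin states → Bool
  δ : Fin states → B → Fin states

/-- State after reading the first `n` symbols of `y`. -/
def Sel1.st (S : Sel1 B) (y : ℕ → B) : ℕ → Fin S.states
  | 0 => S.init
  | n + 1 => S.δ (S.st y n) (y n)

/-- The word selected from the first `n` symbols of `y`. -/
def Sel1.outList (S : Sel1 B) (y : ℕ → B) (n : ℕ) : List B :=
  (List.range n).filterMap fun i => if S.sel (S.st y i) then some (y i) else none

/-! ### Shufflers -/

/-- A shuffler over the alphabet `A`: at a state of type I it reads, outputs and moves
on the next symbol of the first input; at a state of type II it does so with the second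
input. -/
structure Shuffler (A : Type*) where
  states : ℕ
  init : Fin states
  tyI : Fin states → Bool
  δ : Fin states → A → Fin states

/-- Configuration (current state, symbols read from `x`, symbols read from `y`)
after `n` steps. -/
def Shuffler.cfg (S : Shuffler A) (x y : ℕ → A) : ℕ → Fin S.states × ℕ × ℕ
  | 0 => (S.init, 0, 0)
  | n + 1 =>
    let c := S.cfg x y n
    if S.tyI c.1 then (S.δ c.1 (x c.2.1), c.2.1 + 1, c.2.2)
    else (S.δ c.1 (y c.2.2), c.2.1, c.2.2 + 1)

/-- The output `S(x,y)` of the shuffler `S` on inputs `x` and `y`. -/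
def Shuffler.out (S : Shuffler A) (x y : ℕ → A) (n : ℕ) : A :=
  let c := S.cfg x y n
  if S.tyI c.1 then x c.2.1 else y c.2.2

/-! ### Look-ahead automata -/

/-- The transitions of the look-ahead automaton `𝒜_{k,ℓ}`. -/
def lookTrans (M : TwoAut A B Q) (k ℓ : ℕ) :
    Set ((Q × List A × List B) × (Option A × Option B) × (Q × List A × List B)) :=
  {t | (∃ (q : Q) (u : List A) (a : A), u.length < k ∧
          t = ((q, u, []), (some a, none), (q, u ++ [a], ([] : List B)))) ∨
       (∃ (q : Q) (u : List A) (v : List B) (b : B), u.length = k ∧ v.length < ℓ ∧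
          t = ((q, u, v), (none, some b), (q, u, v ++ [b]))) ∨
       (∃ (q q' : Q) (a a' : A) (u' : List A) (v : List B),
          u'.length = k - 1 ∧ v.length = ℓ ∧ (q, (some a, none), q') ∈ M.trans ∧
          t = ((q, a :: u', v), (some a', none), (q', u' ++ [a'], v))) ∨
       (∃ (q q' : Q) (b b' : B) (u : List A) (v' : List B),
          u.length = k ∧ v'.length = ℓ - 1 ∧ (q, (none, some b), q') ∈ M.trans ∧
          t = ((q, u, b :: v'), (none, some b'), (q', u, v' ++ [b'])))}

/-- The (finite) set of states of the look-ahead automaton with full buffers,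
i.e. `Q × A^k × B^ℓ`. -/
noncomputable def fullFinset (Q A B : Type*) [Fintype Q] [Fintype A] [Fintype B]
    (k ℓ : ℕ) : Finset (Q × List A × List B) :=
  letI := Classical.decEq (Q × List A × List B)
  (Finset.univ : Finset (Q × (Fin k → A) × (Fin ℓ → B))).image
    fun s => (s.1, List.ofFn s.2.1, List.ofFn s.2.2)

/-! ### Counting words and measures -/

/-- The number of words of length `n` with exactly `i` occurrences of `γ`. -/
noncomputable def Ncount (γ : List A) (i n : ℕ) : ℕ :=
  Nat.card {w : List A // w.length = n ∧ occ w γ = i}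

/-- The cylinder of infinite words starting with `w`. -/
def cylinder (w : List A) : Set (ℕ → A) := {x : ℕ → A | pref x w.length = w}

/-- The set `E_S(ε,γ,n)` of pairs of inputs for which the frequency of `γ` in the first
`n` symbols of `S(x,y)` deviates from `|A|^{-|γ|}` by less than `ε`. -/
def Eset [Fintype A] (S : Shuffler A) (ε : ℝ) (γ : List A) (n : ℕ) :
    Set ((ℕ → A) × (ℕ → A)) :=
  {p : (ℕ → A) × (ℕ → A) |
    |(occ (pref (S.out p.1 p.2) n) γ : ℝ) - (n : ℝ) / (Fintype.card A : ℝ) ^ γ.length|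
      < ε * n}

/-- The set `F(ε,t,ℓ,n)`. -/
def Fset [Fintype A] (S : ℕ → Shuffler A) (ε : ℝ) (t ℓ n : ℕ) :
    Set ((ℕ → A) × (ℕ → A)) :=
  ⋂ i ∈ Finset.Icc 1 t, ⋂ r ∈ Finset.Icc 1 ℓ,
    ⋂ γ ∈ {γ : List A | γ.length = r}, Eset (S i) ε γ n

/-- `ℓ_n = (log_{|A|} n)/3`. -/
noncomputable def ellSeq (A : Type*) [Fintype A] (n : ℕ) : ℝ :=
  Real.logb (Fintype.card A) n / 3

/-- `ε_n = 2 √((log n · log_{|A|} n)/n)`. -/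
noncomputable def epsSeq (A : Type*) [Fintype A] (n : ℕ) : ℝ :=
  2 * Real.sqrt (Real.log n * Real.logb (Fintype.card A) n / n)

/-- `F_n = F(ε_n, t_n, ℓ_n, n)` with `t_n = n`. -/
noncomputable def Fn [Fintype A] (S : ℕ → Shuffler A) (n : ℕ) :
    Set ((ℕ → A) × (ℕ → A)) :=
  Fset S (epsSeq A n) n (⌊ellSeq A n⌋).toNat n

/-- `n_start`, the least `n` such that `ε_n ≥ 6/⌊n/ℓ_n⌋`. -/
noncomputable def nStart (A : Type*) [Fintype A] : ℕ :=
  sInf {m : ℕ | 0 < ⌊(m : ℝ) / ellSeq A m⌋ ∧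
    6 / ((⌊(m : ℝ) / ellSeq A m⌋ : ℤ) : ℝ) ≤ epsSeq A m}

/-- `G_n = ⋂_{j=0}^{n} F_{|A|^{n_0+j}}` where `|A|^{n_0} = n_start`. -/
noncomputable def Gn [Fintype A] (S : ℕ → Shuffler A) (n : ℕ) :
    Set ((ℕ → A) × (ℕ → A)) :=
  ⋂ j ∈ Finset.range (n + 1), Fn S (nStart A * Fintype.card A ^ j)

/-! ### Concatenations of list-valued sequences -/

/-- The concatenation `f a ++ f (a + 1) ++ ⋯ ++ f (b - 1)`. -/
def seg {α : Type*} (f : ℕ → List α) (a b : ℕ) : List α := (List.Ico a b).flatMap f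

section Seg
variable {α T : Type*}

@[simp] lemma seg_self (f : ℕ → List α) (a : ℕ) : seg f a a = [] := by simp [seg]

lemma seg_append (f : ℕ → List α) {a b c : ℕ} (hab : a ≤ b) (hbc : b ≤ c) :
    seg f a b ++ seg f b c = seg f a c := by
  simp only [seg]
  rw [← List.flatMap_append, List.Ico.append_consecutive hab hbc]

lemma seg_succ (f : ℕ → List α) {a b : ℕ} (hab : a ≤ b) :
    seg f a (b + 1) = seg f a b ++ f b := by
  simp [seg, List.Ico.succ_top hab]

lemma seg_one (f : ℕ → List α) (a : ℕ) : seg f a (a + 1) = f a := by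
  simp [seg_succ]

lemma seg_cons (f : ℕ → List α) {a b : ℕ} (hab : a < b) :
    seg f a b = f a ++ seg f (a + 1) b := by
  rw [← seg_append f (Nat.le_succ a) hab, seg_one]

lemma seg_congr {f f' : ℕ → List α} {a a' : ℕ} (n : ℕ)
    (h : ∀ i < n, f (a + i) = f' (a' + i)) : seg f a (a + n) = seg f' a' (a' + n) := by
  induction n with
  | zero => simp
  | succ n ih =>
    rw [← Nat.add_assoc, ← Nat.add_assoc, seg_succ f (Nat.le_add_right _ _),
      seg_succ f' (Nat.le_add_right _ _), ih fun i hi => h i (by omega), h n (by omega)]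

lemma seg_comp (f : ℕ → List α) {g : ℕ → ℕ} (hg : Monotone g) {m n : ℕ} (h : m ≤ n) :
    seg (fun t => seg f (g t) (g (t + 1))) m n = seg f (g m) (g n) := by
  induction n, h using Nat.le_induction with
  | base => simp
  | succ n hmn ih =>
    rw [seg_succ _ hmn, ih, seg_append f (hg hmn) (hg n.le_succ)]

lemma seg_zero_prefix (f : ℕ → List α) {m n : ℕ} (h : m ≤ n) : seg f 0 m <+: seg f 0 n :=
  ⟨seg f m n, seg_append f (Nat.zero_le _) h⟩

lemma seg_eq_nil {f : ℕ → List α} {a b : ℕ} (h : ∀ i, a ≤ i → i < b → f i = []) :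
    seg f a b = [] := by
  simp only [seg, List.flatMap_eq_nil_iff, List.Ico.mem]
  exact fun i hi => h i hi.1 hi.2

lemma length_seg_mono (f : ℕ → List α) {m n : ℕ} (h : m ≤ n) :
    (seg f 0 m).length ≤ (seg f 0 n).length := (seg_zero_prefix f h).length_le

lemma flatten_map_range (f : ℕ → List α) (n : ℕ) :
    ((List.range n).map f).flatten = seg f 0 n := by
  simp [seg, List.Ico.zero_bot, List.flatMap]

lemma reduceOption_map_range (f : ℕ → Option α) (n : ℕ) :
    ((List.range n).map f).reduceOption = seg (fun i => (f i).toList) 0 n := by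
  induction n with
  | zero => simp
  | succ n ih =>
    rw [List.range_succ, List.map_append, List.reduceOption_append, ih,
      seg_succ _ (Nat.zero_le _)]
    cases h : f n <;> simp [h]

lemma length_pref (x : ℕ → α) (n : ℕ) : (pref x n).length = n := by simp [pref]

lemma pref_eq_seg (x : ℕ → α) (n : ℕ) : pref x n = seg (fun i => [x i]) 0 n := by
  rw [← flatten_map_range]
  simp only [pref]
  induction n with
  | zero => simp
  | succ n ih => simp [List.range_succ, ih]

lemma pref_prefix (x : ℕ → α) {m n : ℕ} (h : m ≤ n) : pref x m <+: pref x n := by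
  rw [pref_eq_seg, pref_eq_seg]; exact seg_zero_prefix _ h

lemma eq_pref_of_prefix {x : ℕ → α} {l : List α} {n : ℕ} (h : l <+: pref x n) :
    l = pref x l.length := by
  have hl : l.length ≤ n := by simpa [length_pref] using h.length_le
  exact (List.prefix_of_prefix_length_le h (pref_prefix x hl)
    (by rw [length_pref])).eq_of_length (by rw [length_pref])

lemma eq_of_pref_eq {x x' : ℕ → α} (h : ∀ n, ∃ m, n ≤ m ∧ pref x m = pref x' m) : x = x' := by
  funext n
  obtain ⟨m, hm, he⟩ := h (n + 1)
  have := congrArg (fun l => l[n]?) he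
  simpa [pref, List.getElem?_range (show n < m by omega)] using this

/-- A sequence of lists of unbounded total length determines an infinite word. -/
lemma exists_limit (f : ℕ → List α) (h : Tendsto (fun n => (seg f 0 n).length) atTop atTop) :
    ∃ x : ℕ → α, ∀ n, seg f 0 n = pref x (seg f 0 n).length := by
  have hk : ∀ i, ∃ n, i < (seg f 0 n).length := fun i =>
    ((tendsto_atTop.1 h (i + 1)).exists).imp fun n hn => hn
  choose k hk using hk
  refine ⟨fun i => (seg f 0 (k i))[i]'(hk i), fun n => ?_⟩
  apply List.ext_getElem
  · rw [length_pref]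
  · intro i h1 h2
    simp only [pref, List.getElem_map, List.getElem_range]
    rcases le_total n (k i) with hle | hle
    · exact (seg_zero_prefix f hle).getElem h1
    · exact ((seg_zero_prefix f hle).getElem (hk i)).symm

/-! ### Splicing a sequence of transitions -/

/-- The sequence `γ 0, …, γ (n-1), γ n', …, γ (n₁'-1), γ n₁, γ (n₁+1), …`. -/
def splice (γ : ℕ → T) (n n' n₁' n₁ : ℕ) (i : ℕ) : T :=
  if i < n then γ i else if i < n + (n₁' - n') then γ (n' + (i - n))
  else γ (n₁ + (i - (n + (n₁' - n'))))

lemma splice_eq_some (γ : ℕ → T) (n n' n₁' n₁ i : ℕ) : ∃ j, splice γ n n' n₁' n₁ i = γ j := by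
  unfold splice; split_ifs <;> exact ⟨_, rfl⟩

lemma seg_splice (γ : ℕ → T) (F : T → List α) {n n' n₁' n₁ : ℕ} (h : n' ≤ n₁') (j : ℕ) :
    seg (fun i => F (splice γ n n' n₁' n₁ i)) 0 (n + (n₁' - n') + j) =
      seg (fun i => F (γ i)) 0 n ++ seg (fun i => F (γ i)) n' n₁' ++
        seg (fun i => F (γ i)) n₁ (n₁ + j) := by
  rw [← seg_append _ (Nat.zero_le (n + (n₁' - n'))) (Nat.le_add_right _ _),
    ← seg_append _ (Nat.zero_le n) (Nat.le_add_right _ _)]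
  congr 1
  · congr 1
    · have := seg_congr (f := fun i => F (splice γ n n' n₁' n₁ i)) (f' := fun i => F (γ i))
        (a := 0) (a' := 0) n (fun i hi => by simp [splice, hi])
      simpa using this
    · have := seg_congr (f := fun i => F (splice γ n n' n₁' n₁ i)) (f' := fun i => F (γ i))
        (a := n) (a' := n') (n₁' - n') (fun i hi => by simp [splice, hi])
      rwa [Nat.add_sub_cancel' h] at this
  · refine seg_congr j fun i hi => ?_
    simp only [splice, show ¬ n + (n₁' - n') + i < n by omega,
      show ¬ n + (n₁' - n') + i < n + (n₁' - n') by omega, if_false, Nat.add_sub_cancel_left]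

lemma seg_splice_of_eq (γ : ℕ → T) (F : T → List α) {n n' n₁' n₁ : ℕ} (h : n' ≤ n₁')
    (h1 : n ≤ n₁) (he : seg (fun i => F (γ i)) n n₁ = seg (fun i => F (γ i)) n' n₁') (j : ℕ) :
    seg (fun i => F (splice γ n n' n₁' n₁ i)) 0 (n + (n₁' - n') + j) =
      seg (fun i => F (γ i)) 0 (n₁ + j) := by
  rw [seg_splice γ F h, ← he, seg_append _ (Nat.zero_le _) h1,
    seg_append _ (Nat.zero_le _) (Nat.le_add_right _ _)]

lemma splice_chain {γ : ℕ → T} {src tgt : T → Q} (hc : ∀ i, tgt (γ i) = src (γ (i + 1)))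
    {n n' n₁' n₁ : ℕ} (h : n' ≤ n₁') (h0 : src (γ n) = src (γ n'))
    (h1 : src (γ n₁) = src (γ n₁')) (i : ℕ) :
    tgt (splice γ n n' n₁' n₁ i) = src (splice γ n n' n₁' n₁ (i + 1)) := by
  unfold splice
  rcases lt_trichotomy (i + 1) n with hi | hi | hi
  · simp [hi, show i < n by omega, hc]
  · subst hi
    simp only [Nat.lt_succ_self, if_true, lt_irrefl, if_false, hc]
    by_cases h2 : n' = n₁'
    · subst h2; simp [h0, h1]
    · simp [show n' < n₁' by omega, h0]
  · simp only [show ¬ i < n by omega, show ¬ i + 1 < n by omega, if_false]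
    rcases lt_trichotomy (i + 1) (n + (n₁' - n')) with h2 | h2 | h2
    · simp [h2, show i < n + (n₁' - n') by omega, hc, show n' + (i + 1 - n) = n' + (i - n) + 1 by omega]
    · simp only [show i < n + (n₁' - n') by omega, h2, lt_irrefl, if_true, if_false, hc]
      simp [h1, show n' + (i - n) + 1 = n₁' by omega]
    · simp only [show ¬ i < n + (n₁' - n') by omega, show ¬ i + 1 < n + (n₁' - n') by omega,
        if_false, hc]
      congr 2; omega

lemma splice_src_zero {γ : ℕ → T} {src : T → Q} {n n' n₁' n₁ : ℕ} (h : n' ≤ n₁')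
    (h0 : src (γ n) = src (γ n')) (h1 : src (γ n₁) = src (γ n₁')) :
    src (splice γ n n' n₁' n₁ 0) = src (γ 0) := by
  unfold splice
  split_ifs with h2 h3
  · rfl
  · obtain rfl : n = 0 := by omega
    simp [h0]
  · obtain rfl : n = 0 := by omega
    obtain rfl : n' = n₁' := by omega
    simp [h0, h1]

lemma tendsto_seg_splice (γ : ℕ → T) (F : T → List α) {n n' n₁' n₁ : ℕ} (h : n' ≤ n₁')
    (ht : Tendsto (fun i => (seg (fun i => F (γ i)) 0 i).length) atTop atTop) :
    Tendsto (fun i => (seg (fun i => F (splice γ n n' n₁' n₁ i)) 0 i).length) atTop atTop := by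
  rw [tendsto_atTop]
  intro b
  obtain ⟨M, hM⟩ := ((tendsto_atTop.1 ht (b + (seg (fun i => F (γ i)) 0 n₁).length)).and
    (eventually_ge_atTop n₁)).exists
  obtain ⟨j, rfl⟩ := Nat.exists_eq_add_of_le hM.2
  filter_upwards [eventually_ge_atTop (n + (n₁' - n') + j)] with i hi
  refine le_trans ?_ (length_seg_mono _ hi)
  have h3 := hM.1
  rw [← seg_append _ (Nat.zero_le n₁) (Nat.le_add_right _ _), List.length_append] at h3
  rw [seg_splice γ F h]
  simp only [List.length_append]
  omega

end Seg

/-! ### Frequencies of aligned blocks -/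

section Blocks
variable [Fintype A]

/-- The word `x a, x (a + 1), …, x (a + ℓ - 1)`. -/
def word (x : ℕ → A) (a ℓ : ℕ) : List A := seg (fun i => [x i]) a (a + ℓ)

omit [Fintype A] in
lemma length_word (x : ℕ → A) (a ℓ : ℕ) : (word x a ℓ).length = ℓ := by
  induction ℓ with
  | zero => simp [word]
  | succ n ih =>
    unfold word at *
    rw [← Nat.add_assoc, seg_succ _ (Nat.le_add_right _ _)]
    simp [ih]

omit [Fintype A] in
lemma word_add (x : ℕ → A) (a m n : ℕ) : word x a (m + n) = word x a m ++ word x (a + m) n := by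
  unfold word
  rw [← Nat.add_assoc, seg_append _ (Nat.le_add_right _ _) (Nat.le_add_right _ _)]

omit [Fintype A] in
lemma take_drop_pref (x : ℕ → A) {n i ℓ : ℕ} (h : i + ℓ ≤ n) :
    ((pref x n).drop i).take ℓ = word x i ℓ := by
  obtain ⟨m, rfl⟩ := Nat.exists_eq_add_of_le h
  have h0 : pref x (i + ℓ + m) = pref x i ++ (word x i ℓ ++ word x (i + ℓ) m) := by
    rw [pref_eq_seg, pref_eq_seg, ← word_add, word, Nat.add_assoc,
      seg_append _ (Nat.zero_le _) (Nat.le_add_right _ _)]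
  rw [h0, List.drop_left' (length_pref x i), List.take_left' (length_word _ _ _)]

open Classical in
/-- The number of `I < n` such that `p (x[Iℓ, Iℓ + ℓ))`. -/
noncomputable def blockCount (x : ℕ → A) (ℓ : ℕ) (p : List A → Prop) (n : ℕ) : ℕ :=
  ((Finset.range n).filter fun I => p (word x (I * ℓ) ℓ)).card

omit [Fintype A] in
lemma alocc_pref (x : ℕ → A) {ℓ : ℕ} (hℓ : 1 ≤ ℓ) {u : List A} (hu : u.length = ℓ) (n : ℕ) :
    alocc (pref x (n * ℓ)) u = blockCount x ℓ (· = u) n := by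
  classical
  unfold alocc blockCount
  rw [hu, length_pref, ← Nat.card_eq_finsetCard]
  have key : ∀ I, I < n ↔ I * ℓ + ℓ ≤ n * ℓ := fun I => by
    rw [← Nat.succ_mul, Nat.mul_le_mul_right_iff (by omega)]; exact Iff.rfl
  refine Nat.card_congr ⟨fun i => ⟨i.1 / ℓ, ?_⟩, fun I => ⟨I.1 * ℓ, ?_⟩, fun i => ?_, fun I => ?_⟩
  · obtain ⟨i, h1, h2, h3⟩ := i
    have h4 : i / ℓ * ℓ = i := Nat.div_mul_cancel (Nat.dvd_of_mod_eq_zero h2)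
    rw [take_drop_pref x h1] at h3
    simp only [Finset.mem_filter, Finset.mem_range, key, h4]
    exact ⟨h1, h3⟩
  · have h1 := I.2
    simp only [Finset.mem_filter, Finset.mem_range, key] at h1
    exact ⟨h1.1, Nat.mul_mod_left _ _, by rw [take_drop_pref x h1.1]; exact h1.2⟩
  · exact Subtype.ext (Nat.div_mul_cancel (Nat.dvd_of_mod_eq_zero i.2.2.1))
  · exact Subtype.ext (Nat.mul_div_cancel _ (by omega))

/-- Words of a fixed length. -/
noncomputable def words (A : Type*) [Fintype A] (ℓ : ℕ) : Finset (List A) :=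
  letI := Classical.decEq A
  (Finset.univ : Finset (Fin ℓ → A)).map ⟨List.ofFn, List.ofFn_injective⟩

lemma mem_words {ℓ : ℕ} {u : List A} : u ∈ words A ℓ ↔ u.length = ℓ := by
  unfold words
  rw [Finset.mem_map]
  constructor
  · rintro ⟨v, -, rfl⟩
    exact List.length_ofFn
  · rintro rfl
    exact ⟨u.get, Finset.mem_univ _, List.ofFn_get u⟩

lemma card_words (ℓ : ℕ) : (words A ℓ).card = Fintype.card A ^ ℓ := by
  classical
  unfold words
  rw [Finset.card_map, Finset.card_univ]
  simp

lemma blockCount_eq_sum (x : ℕ → A) (ℓ : ℕ) (p : List A → Prop) [DecidablePred p] (n : ℕ) :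
    blockCount x ℓ p n = ∑ u ∈ (words A ℓ).filter p, blockCount x ℓ (· = u) n := by
  classical
  unfold blockCount
  rw [Finset.card_eq_sum_card_fiberwise (f := fun I => word x (I * ℓ) ℓ)
    (t := (words A ℓ).filter p)]
  · refine Finset.sum_congr rfl fun u hu => ?_
    congr 1
    ext I
    simp only [Finset.mem_filter, Finset.mem_range] at hu ⊢
    constructor
    · rintro ⟨⟨h1, h2⟩, h3⟩; exact ⟨h1, h3⟩
    · rintro ⟨h1, h3⟩; exact ⟨⟨h1, h3 ▸ hu.2⟩, h3⟩
  · intro I hI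
    simp only [Finset.coe_filter, Finset.mem_range, Set.mem_ofPred_eq, mem_words] at hI ⊢
    exact ⟨length_word _ _ _, hI.2⟩

lemma Normal.tendsto_blockCount {x : ℕ → A} (hx : Normal x) {ℓ : ℕ} (hℓ : 1 ≤ ℓ)
    (p : List A → Prop) [DecidablePred p] :
    Tendsto (fun n => (blockCount x ℓ p n : ℝ) / n) atTop
      (𝓝 ((((words A ℓ).filter p).card : ℝ) / (Fintype.card A : ℝ) ^ ℓ)) := by
  have h : ∀ u ∈ (words A ℓ).filter p,
      Tendsto (fun n => (blockCount x ℓ (· = u) n : ℝ) / n) atTop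
        (𝓝 ((Fintype.card A : ℝ)⁻¹ ^ ℓ)) := by
    intro u hu
    have hu' := mem_words.1 (Finset.mem_filter.1 hu).1
    simpa only [alocc_pref x hℓ hu'] using hx ℓ hℓ u hu'
  have h2 := tendsto_finsetSum _ h
  rw [Finset.sum_const, nsmul_eq_mul, inv_pow, ← div_eq_mul_inv] at h2
  refine h2.congr fun n => ?_
  rw [blockCount_eq_sum, Nat.cast_sum, Finset.sum_div]

lemma normal_of_tendsto_blockCount {x : ℕ → A}
    (h : ∀ ℓ, 1 ≤ ℓ → ∀ u : List A, u.length = ℓ →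
      Tendsto (fun n => (blockCount x ℓ (· = u) n : ℝ) / n) atTop
        (𝓝 ((Fintype.card A : ℝ)⁻¹ ^ ℓ))) : Normal x := by
  intro ℓ hℓ u hu
  simpa only [alocc_pref x hℓ hu] using h ℓ hℓ u hu

end Blocks

/-! ### Incompressibility of normal words by deterministic machines -/

section Core
variable {K : Type*} {z : ℕ → A} {s : ℕ → K} {ty : K → Bool} {δ : K → A → K}

/-- The symbols of `z` read at states of type `b`. -/
def readAt (z : ℕ → A) (s : ℕ → K) (ty : K → Bool) (b : Bool) (t : ℕ) : List A :=
  if ty (s t) = b then [z t] else []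

lemma length_readAt_add (z : ℕ → A) (s : ℕ → K) (ty : K → Bool) (m N : ℕ) :
    (seg (readAt z s ty true) m (m + N)).length +
      (seg (readAt z s ty false) m (m + N)).length = N := by
  induction N with
  | zero => simp
  | succ N ih =>
    rw [← Nat.add_assoc, seg_succ _ (Nat.le_add_right _ _), seg_succ _ (Nat.le_add_right _ _)]
    cases h : ty (s (m + N)) <;> simp [readAt, h] <;> omega

lemma word_eq_of_readAt_eq (hs : ∀ t, s (t + 1) = δ (s t) (z t)) (N m m' : ℕ)
    (h0 : s m = s m')
    (h : ∀ b, seg (readAt z s ty b) m (m + N) = seg (readAt z s ty b) m' (m' + N)) :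
    word z m N = word z m' N := by
  induction N generalizing m m' with
  | zero => simp [word]
  | succ N ih =>
    have h1 : ∀ b a, seg (readAt z s ty b) a (a + (N + 1)) =
        readAt z s ty b a ++ seg (readAt z s ty b) (a + 1) (a + 1 + N) := fun b a => by
      rw [seg_cons _ (by omega), show a + 1 + N = a + (N + 1) by omega]
    simp only [h1] at h
    have hz : z m = z m' := by
      have := h (ty (s m))
      simp only [readAt, h0, if_true, List.singleton_append, List.cons.injEq] at this
      exact this.1
    have h2 : ∀ b, readAt z s ty b m = readAt z s ty b m' := fun b => by
      simp [readAt, h0, hz]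
    rw [Nat.add_comm N 1, word_add, word_add]
    congr 1
    · simp [word, seg_one, hz]
    · refine ih _ _ (by rw [hs, hs, h0, hz]) fun b => ?_
      have := h b
      rw [h2, List.append_cancel_left_eq] at this
      exact this

variable [Fintype A]

lemma card_short_words (hA : 2 ≤ Fintype.card A) [Finite K]
    (hs : ∀ t, s (t + 1) = δ (s t) (z t)) {d : ℕ} (hd : 2 ≤ d) (o : ℕ → List (Fin d))
    (inj : ∀ m m' N, s m = s m' → s (m + N) = s (m' + N) →
      seg (readAt z s ty false) m (m + N) = seg (readAt z s ty false) m' (m' + N) →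
      seg o m (m + N) = seg o m' (m' + N) →
      seg (readAt z s ty true) m (m + N) = seg (readAt z s ty true) m' (m' + N))
    {ε : ℝ} (hε : 0 < ε) (N : ℕ) (S : Finset (List A))
    (hS : ∀ w ∈ S, ∃ m, w = word z m N ∧ ((seg o m (m + N)).length : ℝ) * Real.log d <
      ((seg (readAt z s ty true) m (m + N)).length - ε * N) * Real.log (Fintype.card A)) :
    (S.card : ℝ) ≤ (Nat.card K : ℝ) ^ 2 * ((N + 1) * (N * Fintype.card A + 1)) *
      Real.exp ((N - ε * N) * Real.log (Fintype.card A)) := by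
  classical
  have : Fintype K := Fintype.ofFinite K
  set k := Fintype.card A
  have hlk : 0 < Real.log k := Real.log_pos (by exact_mod_cast hA)
  have hld : 0 < Real.log d := Real.log_pos (by exact_mod_cast hd)
  choose! m hm1 hm2 using hS
  let I : Finset (K × K × ℕ × ℕ) :=
    Finset.univ ×ˢ Finset.univ ×ˢ Finset.range (N + 1) ×ˢ Finset.range (N * k + 1)
  let φ : List A → K × K × ℕ × ℕ := fun w =>
    (s (m w), s (m w + N), (seg (readAt z s ty false) (m w) (m w + N)).length,
      (seg o (m w) (m w + N)).length)
  have hmap : ∀ w ∈ S, φ w ∈ I := by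
    intro w hw
    simp only [I, φ, Finset.mem_product, Finset.mem_univ, Finset.mem_range, true_and]
    have h1 := length_readAt_add z s ty (m w) N
    refine ⟨by omega, ?_⟩
    have h2 := hm2 w hw
    have h3 : ((seg (readAt z s ty true) (m w) (m w + N)).length : ℝ) ≤ N := by
      exact_mod_cast (by omega)
    have h4 : Real.log k ≤ k * Real.log d := by
      calc Real.log k ≤ Real.log ((d : ℝ) ^ k) := by
            refine Real.log_le_log (by positivity) ?_
            have : k < d ^ k := Nat.lt_pow_self (by omega)
            exact_mod_cast this.le
        _ = k * Real.log d := by rw [Real.log_pow]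
    have h5 : ((seg o (m w) (m w + N)).length : ℝ) * Real.log d ≤ (N * k) * Real.log d := by
      have : (0 : ℝ) ≤ ε * N := by positivity
      calc _ ≤ _ := h2.le
        _ ≤ N * Real.log k := by gcongr; linarith
        _ ≤ N * (k * Real.log d) := by gcongr
        _ = _ := by ring
    have h6 := le_of_mul_le_mul_right h5 hld
    have : (seg o (m w) (m w + N)).length ≤ N * k := by exact_mod_cast h6
    omega
  have hfib : ∀ i ∈ I, ((S.filter fun w => φ w = i).card : ℝ) ≤
      Real.exp ((N - ε * N) * Real.log k) := by
    rintro ⟨p, q, j, l⟩ -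
    rcases (S.filter fun w => φ w = (p, q, j, l)).eq_empty_or_nonempty with he | ⟨w₀, hw₀⟩
    · rw [he]; simp; positivity
    have hcard : (S.filter fun w => φ w = (p, q, j, l)).card ≤ k ^ j * d ^ l := by
      have : (words A j ×ˢ words (Fin d) l).card = k ^ j * d ^ l := by
        rw [Finset.card_product, card_words, card_words, Fintype.card_fin]
      rw [← this]
      refine Finset.card_le_card_of_injOn (fun w =>
        (seg (readAt z s ty false) (m w) (m w + N), seg o (m w) (m w + N))) ?_ ?_
      · intro w hw
        simp only [φ, Finset.coe_filter, Set.mem_ofPred_eq, Prod.mk.injEq] at hw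
        simp only [Finset.coe_product, Set.mem_prod, Finset.mem_coe, mem_words]
        exact ⟨hw.2.2.2.1, hw.2.2.2.2⟩
      · intro w hw w' hw' he
        simp only [φ, Finset.coe_filter, Set.mem_ofPred_eq, Prod.mk.injEq] at hw hw' he
        have h0 := hw.2.1.trans hw'.2.1.symm
        have h1 := inj _ _ N h0 (hw.2.2.1.trans hw'.2.2.1.symm) he.1 he.2
        rw [hm1 w hw.1, hm1 w' hw'.1]
        exact word_eq_of_readAt_eq hs N _ _ h0 fun b => b.rec he.1 h1
    simp only [φ, Finset.mem_filter, Prod.mk.injEq] at hw₀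
    have h1 := length_readAt_add z s ty (m w₀) N
    have h2 := hm2 w₀ hw₀.1
    rw [hw₀.2.2.2.1] at h1
    rw [hw₀.2.2.2.2] at h2
    have h3 : ((seg (readAt z s ty true) (m w₀) (m w₀ + N)).length : ℝ) = N - j := by
      rw [eq_sub_iff_add_eq]; exact_mod_cast h1
    rw [h3] at h2
    calc ((S.filter fun w => φ w = (p, q, j, l)).card : ℝ) ≤ (k : ℝ) ^ j * (d : ℝ) ^ l := by
          exact_mod_cast hcard
      _ = Real.exp (j * Real.log k + l * Real.log d) := by
          rw [Real.exp_add, Real.exp_nat_mul, Real.exp_nat_mul,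
            Real.exp_log (by positivity), Real.exp_log (by positivity)]
      _ ≤ _ := by
          apply Real.exp_le_exp.2
          nlinarith
  rw [Finset.card_eq_sum_card_fiberwise hmap, Nat.cast_sum]
  refine (Finset.sum_le_card_nsmul _ _ _ hfib).trans (le_of_eq ?_)
  simp only [I, Finset.card_product, Finset.card_univ, Finset.card_range, nsmul_eq_mul,
    Nat.card_eq_fintype_card]
  push_cast
  ring

lemma tendsto_short_words_bound (C : ℝ) {k : ℕ} (hk : 2 ≤ k) {ε : ℝ} (hε : 0 < ε) :
    Tendsto (fun N : ℕ => C ^ 2 * ((N + 1) * (N * k + 1)) *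
      Real.exp ((N - ε * N) * Real.log k) / (k : ℝ) ^ N) atTop (𝓝 0) := by
  set r := Real.exp (-(ε * Real.log k))
  have hlk : 0 < Real.log k := Real.log_pos (by exact_mod_cast hk)
  have hr : |r| < 1 := by
    rw [abs_of_pos (Real.exp_pos _), Real.exp_lt_one_iff]
    have := mul_pos hε hlk
    linarith
  have h2 := tendsto_pow_const_mul_const_pow_of_abs_lt_one 2 hr
  have h1 := tendsto_pow_const_mul_const_pow_of_abs_lt_one 1 hr
  have h0 := tendsto_pow_const_mul_const_pow_of_abs_lt_one 0 hr
  have h := (((h2.const_mul (k : ℝ)).add (h1.const_mul ((k : ℝ) + 1))).add h0).const_mul (C ^ 2)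
  simp only [mul_zero, add_zero] at h
  refine h.congr fun N => ?_
  have : Real.exp ((N - ε * N) * Real.log k) = (k : ℝ) ^ N * r ^ N := by
    have hk0 : (0 : ℝ) < k := by positivity
    rw [← Real.exp_nat_mul, ← Real.exp_log (pow_pos hk0 N), ← Real.exp_add, Real.log_pow]
    congr 1; ring
  rw [this]
  have : (k : ℝ) ^ N ≠ 0 := by positivity
  field_simp
  ring

end Core

section CoreBound
variable {K : Type*} {z : ℕ → A} {s : ℕ → K} {ty : K → Bool} {δ : K → A → K}

lemma blockCount_succ (x : ℕ → A) (ℓ : ℕ) (p : List A → Prop) [DecidablePred p] (n : ℕ) :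
    blockCount x ℓ p (n + 1) = blockCount x ℓ p n + if p (word x (n * ℓ) ℓ) then 1 else 0 := by
  unfold blockCount
  rw [Finset.range_add_one, Finset.filter_insert]
  split_ifs
  · rw [Finset.card_insert_of_notMem (by simp)]
  · rfl

lemma length_readAt_le (z : ℕ → A) (s : ℕ → K) (ty : K → Bool) (m N : ℕ) :
    (seg (readAt z s ty true) m (m + N)).length ≤ N := by
  have := length_readAt_add z s ty m N
  omega

lemma eventually_div {N : ℕ} (hN : 1 ≤ N) {P : ℕ → Prop} (h : ∀ᶠ n in atTop, P n) :
    ∀ᶠ n in atTop, P (n / N) := by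
  have : Tendsto (fun n : ℕ => n / N) atTop atTop := Nat.tendsto_div_const_atTop (by omega)
  exact this.eventually h

variable [Fintype A]

/-- A finite-state machine reading a normal word, whose output determines the symbols read at
states of type `true` given those read at states of type `false`, cannot compress the former. -/
theorem output_lower_bound (hA : 2 ≤ Fintype.card A) [Finite K] (hz : Normal z)
    (hs : ∀ t, s (t + 1) = δ (s t) (z t)) {d : ℕ} (hd : 2 ≤ d) (o : ℕ → List (Fin d))
    (inj : ∀ m m' N, s m = s m' → s (m + N) = s (m' + N) →
      seg (readAt z s ty false) m (m + N) = seg (readAt z s ty false) m' (m' + N) →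
      seg o m (m + N) = seg o m' (m' + N) →
      seg (readAt z s ty true) m (m + N) = seg (readAt z s ty true) m' (m' + N))
    {ε : ℝ} (hε : 0 < ε) :
    ∀ᶠ n : ℕ in atTop, ((seg (readAt z s ty true) 0 n).length - ε * n) *
      Real.log (Fintype.card A) ≤ ((seg o 0 n).length : ℝ) * Real.log d := by
  classical
  set k := Fintype.card A with hk
  have hlk : 0 < Real.log k := Real.log_pos (by exact_mod_cast hA)
  have hld : 0 < Real.log d := Real.log_pos (by exact_mod_cast hd)
  set η := ε / 3 with hη
  have hη0 : 0 < η := by positivity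
  obtain ⟨N, hN, hN1⟩ := (((tendsto_short_words_bound (Nat.card K) hA hη0).eventually
    (gt_mem_nhds hη0)).and (eventually_ge_atTop 1)).exists
  set p : List A → Prop := fun w => ∃ m, w = word z m N ∧
    ((seg o m (m + N)).length : ℝ) * Real.log d <
      ((seg (readAt z s ty true) m (m + N)).length - η * N) * Real.log k with hp
  have hlt : (((words A N).filter p).card : ℝ) / (k : ℝ) ^ N < η := by
    refine lt_of_le_of_lt ?_ hN
    gcongr
    exact card_short_words hA hs hd o inj hη0 N _ fun w hw => (Finset.mem_filter.1 hw).2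
  have hcount : ∀ᶠ n : ℕ in atTop, (blockCount z N p n : ℝ) ≤ η * n := by
    filter_upwards [(hz.tendsto_blockCount hN1 p).eventually (gt_mem_nhds hlt),
      eventually_gt_atTop 0] with n hn hn0
    have : (0 : ℝ) < n := by exact_mod_cast hn0
    exact ((div_lt_iff₀ this).1 hn).le
  have hblock : ∀ n : ℕ, ((seg (readAt z s ty true) 0 (n * N)).length - η * N * n -
      N * blockCount z N p n) * Real.log k ≤ ((seg o 0 (n * N)).length : ℝ) * Real.log d := by
    intro n
    induction n with
    | zero => simp [blockCount]
    | succ n ih =>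
      rw [Nat.succ_mul, ← seg_append _ (Nat.zero_le (n * N)) (Nat.le_add_right _ _),
        ← seg_append o (Nat.zero_le (n * N)) (Nat.le_add_right _ _), blockCount_succ,
        List.length_append, List.length_append]
      by_cases hpw : p (word z (n * N) N)
      · have h1 : ((seg (readAt z s ty true) (n * N) (n * N + N)).length : ℝ) ≤ N := by
          exact_mod_cast length_readAt_le z s ty (n * N) N
        have h2 : 0 ≤ ((seg o (n * N) (n * N + N)).length : ℝ) * Real.log d := by positivity
        have h3 : 0 ≤ η * N := by positivity
        simp only [hpw, if_true]
        push_cast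
        have : ((seg (readAt z s ty true) (n * N) (n * N + N)).length - η * N - N) *
            Real.log k ≤ 0 := mul_nonpos_of_nonpos_of_nonneg (by linarith) hlk.le
        linarith
      · have h1 : ¬ ((seg o (n * N) (n * N + N)).length : ℝ) * Real.log d <
          ((seg (readAt z s ty true) (n * N) (n * N + N)).length - η * N) * Real.log k :=
          fun h => hpw ⟨n * N, rfl, h⟩
        simp only [hpw, if_false]
        push_cast
        linarith
  have hNbig : ∀ᶠ n : ℕ in atTop, (N : ℝ) ≤ η * n := by
    filter_upwards [eventually_ge_atTop ⌈(N : ℝ) / η⌉₊] with n hn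
    have := Nat.le_of_ceil_le hn
    rwa [div_le_iff₀ hη0, mul_comm] at this
  filter_upwards [eventually_div hN1 hcount, hNbig] with n hn1 hn2
  have hdm : n / N * N + n % N = n := by rw [mul_comm]; exact Nat.div_add_mod n N
  have hmod : n % N < N := Nat.mod_lt _ (by omega)
  have h1 := hblock (n / N)
  have h2 : ((seg o 0 (n / N * N)).length : ℝ) ≤ (seg o 0 n).length := by
    exact_mod_cast length_seg_mono o (Nat.div_mul_le_self n N)
  have h3 : ((seg (readAt z s ty true) 0 n).length : ℝ) ≤
      (seg (readAt z s ty true) 0 (n / N * N)).length + N := by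
    have h4 := seg_append (readAt z s ty true) (Nat.zero_le (n / N * N))
      (Nat.le_add_right _ (n % N))
    have h5 := length_readAt_le z s ty (n / N * N) (n % N)
    rw [hdm] at h4 h5
    rw [← h4, List.length_append]
    exact_mod_cast (by omega)
  have h6 : (N : ℝ) * (n / N : ℕ) ≤ n := by
    rw [mul_comm]; exact_mod_cast Nat.div_mul_le_self n N
  have h7 : (N : ℝ) * blockCount z N p (n / N) ≤ η * n := by
    calc _ ≤ (N : ℝ) * (η * (n / N : ℕ)) := by gcongr
      _ = η * (N * (n / N : ℕ)) := by ring
      _ ≤ _ := by gcongr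
  have h8 : η * N * (n / N : ℕ) ≤ η * n := by
    rw [mul_assoc]; gcongr
  calc _ ≤ ((seg (readAt z s ty true) 0 (n / N * N)).length - η * N * (n / N : ℕ) -
      N * blockCount z N p (n / N)) * Real.log k := by
        refine mul_le_mul_of_nonneg_right ?_ hlk.le
        have : ε * n = 3 * (η * n) := by rw [hη]; ring
        linarith
    _ ≤ _ := h1
    _ ≤ _ := by gcongr

omit [Fintype A] in
/-- Some word forces a read at a state of type `true` from every state from which such a read
is possible for all continuations. -/
lemma exists_forcing_word [Finite K] (ty : K → Bool) (δ : K → A → K) :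
    ∃ W : List A, ∀ (z : ℕ → A) (s : ℕ → K), (∀ t, s (t + 1) = δ (s t) (z t)) →
      (∀ t, ∃ t' ≥ t, ty (s t') = true) → ∀ m, word z m W.length = W →
      ∃ i < W.length, ty (s (m + i)) = true := by
  classical
  have : Fintype K := Fintype.ofFinite K
  suffices h : ∀ P : Finset K, ∃ W : List A, ∀ (z : ℕ → A) (s : ℕ → K),
      (∀ t, s (t + 1) = δ (s t) (z t)) → (∀ t, ∃ t' ≥ t, ty (s t') = true) →
      ∀ m, s m ∈ P → word z m W.length = W → ∃ i < W.length, ty (s (m + i)) = true by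
    obtain ⟨W, hW⟩ := h Finset.univ
    exact ⟨W, fun z s h1 h2 m => hW z s h1 h2 m (Finset.mem_univ _)⟩
  intro P
  induction P using Finset.induction_on with
  | empty => exact ⟨[], fun z s _ _ m hm => absurd hm (Finset.notMem_empty _)⟩
  | insert p P hp ih =>
    obtain ⟨W, hW⟩ := ih
    by_cases hgood : ∃ (z : ℕ → A) (s : ℕ → K), (∀ t, s (t + 1) = δ (s t) (z t)) ∧
      (∀ t, ∃ t' ≥ t, ty (s t') = true) ∧ ∃ m, s m = p ∧ word z m W.length = W
    · obtain ⟨z₀, s₀, h1, h2, m₀, h3, h4⟩ := hgood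
      obtain ⟨t', ht', hty⟩ := h2 (m₀ + W.length)
      obtain ⟨i, rfl⟩ := Nat.exists_eq_add_of_le ht'
      refine ⟨W ++ word z₀ (m₀ + W.length) (i + 1), fun z s hs1 hs2 m hm hw => ?_⟩
      simp only [List.length_append, length_word] at hw ⊢
      rw [word_add] at hw
      have hw' := List.append_inj hw (by rw [length_word])
      rcases Finset.mem_insert.1 hm with hm | hm
      · have hall : ∀ j ≤ W.length + (i + 1), s (m + j) = s₀ (m₀ + j) := by
          have hwz : word z m (W.length + (i + 1)) = word z₀ m₀ (W.length + (i + 1)) := by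
            rw [word_add z, word_add z₀, hw'.1, hw'.2, h4]
          intro j hj
          induction j with
          | zero => simp [hm, h3]
          | succ j ihj =>
            rw [← Nat.add_assoc, ← Nat.add_assoc, hs1, h1, ihj (by omega)]
            congr 1
            obtain ⟨r, hr⟩ := Nat.exists_eq_add_of_lt (show j < W.length + (i + 1) by omega)
            rw [show W.length + (i + 1) = j + (1 + r) by omega, word_add z, word_add z₀] at hwz
            have h5 := (List.append_inj hwz (by simp only [length_word])).2
            rw [word_add z, word_add z₀] at h5
            have h6 := (List.append_inj h5 (by simp only [length_word])).1
            simpa [word, seg_one] using h6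
        exact ⟨W.length + i, by omega, by
          rw [hall _ (by omega), ← Nat.add_assoc]; exact hty⟩
      · obtain ⟨j, hj, hty'⟩ := hW z s hs1 hs2 m hm hw'.1
        exact ⟨j, by omega, hty'⟩
    · refine ⟨W, fun z s hs1 hs2 m hm hw => ?_⟩
      rcases Finset.mem_insert.1 hm with hm | hm
      · exact absurd ⟨z, s, hs1, hs2, m, hm, hw⟩ hgood
      · exact hW z s hs1 hs2 m hm hw

/-- If a finite-state machine on a normal word reads infinitely often at states of type `true`,
it does so with positive lower density. -/
theorem read_density (hA : 2 ≤ Fintype.card A) [Finite K] (hz : Normal z)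
    (hs : ∀ t, s (t + 1) = δ (s t) (z t)) (hinf : ∀ t, ∃ t' ≥ t, ty (s t') = true) :
    ∃ c : ℝ, 0 < c ∧ ∀ᶠ n : ℕ in atTop, c * n ≤ (seg (readAt z s ty true) 0 n).length := by
  classical
  obtain ⟨W, hW⟩ := exists_forcing_word ty δ
  have hW' := hW z s hs hinf
  set ℓ := W.length with hℓ
  rcases Nat.eq_zero_or_pos ℓ with h0 | hpos
  · have hWnil : W = [] := List.eq_nil_of_length_eq_zero (hℓ.symm.trans h0)
    obtain ⟨i, hi, -⟩ := hW' 0 (by rw [h0, hWnil]; simp [word])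
    omega
  set k := Fintype.card A
  have hk0 : (0 : ℝ) < k := by positivity
  have hlim := hz ℓ hpos W rfl
  simp only [alocc_pref z hpos hℓ.symm] at hlim
  set c₀ := (k : ℝ)⁻¹ ^ ℓ / 2 with hc₀
  have hc₀pos : 0 < c₀ := by positivity
  have hev : ∀ᶠ n : ℕ in atTop, c₀ * n ≤ blockCount z ℓ (· = W) n := by
    filter_upwards [hlim.eventually (lt_mem_nhds (show c₀ < (k : ℝ)⁻¹ ^ ℓ by
      rw [hc₀]; exact half_lt_self (by positivity))), eventually_gt_atTop 0] with n hn hn0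
    have : (0 : ℝ) < n := by exact_mod_cast hn0
    exact ((lt_div_iff₀ this).1 hn).le
  have hblock : ∀ n, blockCount z ℓ (· = W) n ≤ (seg (readAt z s ty true) 0 (n * ℓ)).length := by
    intro n
    induction n with
    | zero => simp [blockCount]
    | succ n ih =>
      rw [blockCount_succ, Nat.succ_mul,
        ← seg_append _ (Nat.zero_le (n * ℓ)) (Nat.le_add_right _ _), List.length_append]
      refine Nat.add_le_add ih ?_
      split_ifs with hw
      · obtain ⟨i, hi, hty⟩ := hW' _ hw
        rw [← seg_append _ (Nat.le_add_right (n * ℓ) i) (show n * ℓ + i ≤ n * ℓ + ℓ by omega),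
          seg_cons _ (show n * ℓ + i < n * ℓ + ℓ by omega)]
        simp [readAt, hty]
        omega
      · exact Nat.zero_le _
  refine ⟨c₀ / (2 * ℓ), by positivity, ?_⟩
  filter_upwards [eventually_div hpos hev, eventually_ge_atTop (2 * ℓ)] with n hn hn2
  have hdm : n / ℓ * ℓ + n % ℓ = n := by rw [mul_comm]; exact Nat.div_add_mod n ℓ
  have hmod : n % ℓ < ℓ := Nat.mod_lt _ hpos
  have h1 : (n : ℝ) ≤ 2 * ((n / ℓ : ℕ) * ℓ) := by exact_mod_cast (by omega)
  calc c₀ / (2 * ℓ) * n ≤ c₀ / (2 * ℓ) * (2 * ((n / ℓ : ℕ) * ℓ)) := by gcongr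
    _ = c₀ * (n / ℓ : ℕ) := by
        have : (ℓ : ℝ) ≠ 0 := by positivity
        field_simp
    _ ≤ blockCount z ℓ (· = W) (n / ℓ) := hn
    _ ≤ (seg (readAt z s ty true) 0 (n / ℓ * ℓ)).length := by exact_mod_cast hblock _
    _ ≤ _ := by exact_mod_cast length_seg_mono _ (Nat.div_mul_le_self n ℓ)

end CoreBound

/-! ### Removing the silent steps of a deterministic run -/

/-- The sequence of states and of optional reads of a deterministic finite-state run with
infinitely many reads. -/
structure Trace (K A : Type*) where
  H : ℕ → K
  r : ℕ → Option A
  inf : ∀ h, ∃ i, (r (h + i)).isSome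
  isSome_eq : ∀ h h', H h = H h' → (r h).isSome = (r h').isSome
  succ_eq : ∀ h h', H h = H h' → r h = r h' → H (h + 1) = H (h' + 1)

namespace Trace
variable {K : Type*} (T : Trace K A)

open Classical in
/-- The waiting time until the next read. -/
noncomputable def wait (h : ℕ) : ℕ := Nat.find (T.inf h)

lemma isSome_wait (h : ℕ) : (T.r (h + T.wait h)).isSome := by
  classical exact Nat.find_spec (T.inf h)

lemma eq_none_of_lt_wait {h i : ℕ} (hi : i < T.wait h) : T.r (h + i) = none := by
  classical
  have := Nat.find_min (T.inf h) hi
  simpa using this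

lemma H_add_eq {h h' : ℕ} (he : T.H h = T.H h') {i : ℕ} (hi : i ≤ T.wait h) :
    T.H (h + i) = T.H (h' + i) := by
  induction i with
  | zero => exact he
  | succ i ih =>
    have h1 := ih (by omega)
    have h2 := T.eq_none_of_lt_wait (h := h) (i := i) (by omega)
    have h3 := T.isSome_eq _ _ h1
    rw [h2] at h3
    have h4 : T.r (h' + i) = none := by simpa using h3.symm
    exact T.succ_eq _ _ h1 (h2.trans h4.symm)

lemma wait_le {h h' : ℕ} (he : T.H h = T.H h') : T.wait h' ≤ T.wait h := by
  classical
  refine Nat.find_min' _ ?_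
  rw [← T.isSome_eq _ _ (T.H_add_eq he le_rfl)]
  exact T.isSome_wait h

lemma wait_eq {h h' : ℕ} (he : T.H h = T.H h') : T.wait h = T.wait h' :=
  le_antisymm (T.wait_le he.symm) (T.wait_le he)

lemma wait_bounded [Finite K] : ∃ W, ∀ h, T.wait h ≤ W := by
  classical
  have hfin : (Set.range T.wait).Finite := by
    refine ((Set.finite_range fun q : K =>
      if h : ∃ n, T.H n = q then T.wait h.choose else 0)).subset ?_
    rintro _ ⟨h, rfl⟩
    refine ⟨T.H h, ?_⟩
    have hex : ∃ n, T.H n = T.H h := ⟨h, rfl⟩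
    simp only [hex, dif_pos]
    exact T.wait_eq hex.choose_spec
  obtain ⟨W, hW⟩ := hfin.bddAbove
  exact ⟨W, fun h => hW ⟨h, rfl⟩⟩

/-- The time of the `t`-th read. -/
noncomputable def time : ℕ → ℕ
  | 0 => T.wait 0
  | t + 1 => time t + 1 + T.wait (time t + 1)

lemma time_succ (t : ℕ) : T.time (t + 1) = T.time t + 1 + T.wait (T.time t + 1) := rfl

lemma time_lt_succ (t : ℕ) : T.time t < T.time (t + 1) := by rw [time_succ]; omega

lemma time_strictMono : StrictMono T.time := strictMono_nat_of_lt_succ T.time_lt_succ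

lemma isSome_time : ∀ t, (T.r (T.time t)).isSome
  | 0 => by simpa [time] using T.isSome_wait 0
  | t + 1 => by rw [time_succ]; exact T.isSome_wait _

lemma eq_none_before {h : ℕ} (hh : h < T.time 0) : T.r h = none := by
  simpa using T.eq_none_of_lt_wait (h := 0) hh

lemma eq_none_between {t h : ℕ} (h1 : T.time t < h) (h2 : h < T.time (t + 1)) :
    T.r h = none := by
  obtain ⟨i, rfl⟩ := Nat.exists_eq_add_of_lt h1
  rw [time_succ] at h2
  have := T.eq_none_of_lt_wait (h := T.time t + 1) (i := i) (by omega)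
  rwa [show T.time t + i + 1 = T.time t + 1 + i by omega]

/-- The state at the `t`-th read. -/
noncomputable def st (t : ℕ) : K := T.H (T.time t)

/-- The `t`-th symbol read. -/
noncomputable def sym (t : ℕ) : A := (T.r (T.time t)).get (T.isSome_time t)

lemma r_time (t : ℕ) : T.r (T.time t) = some (T.sym t) := by simp [sym]

lemma st_succ_eq {t t' : ℕ} (h1 : T.st t = T.st t') (h2 : T.sym t = T.sym t') :
    T.st (t + 1) = T.st (t' + 1) := by
  have h3 : T.H (T.time t + 1) = T.H (T.time t' + 1) :=
    T.succ_eq _ _ h1 (by rw [r_time, r_time, h2])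
  simp only [st, time_succ]
  rw [T.H_add_eq h3 le_rfl, T.wait_eq h3]

lemma exists_next : ∃ δ : K → A → K, ∀ t, T.st (t + 1) = δ (T.st t) (T.sym t) := by
  classical
  refine ⟨fun q a => if h : ∃ t, T.st t = q ∧ T.sym t = a then T.st (h.choose + 1) else q,
    fun t => ?_⟩
  have hex : ∃ t', T.st t' = T.st t ∧ T.sym t' = T.sym t := ⟨t, rfl, rfl⟩
  simp only [hex, dif_pos]
  exact T.st_succ_eq hex.choose_spec.1.symm hex.choose_spec.2.symm

/-- The symbol read at time `h` if the state has type `b`. -/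
def rd (ty : K → Bool) (b : Bool) (h : ℕ) : List A := if ty (T.H h) = b then (T.r h).toList else []

variable (ty : K → Bool) (b : Bool)

lemma rd_eq_nil {h : ℕ} (hh : T.r h = none) : T.rd ty b h = [] := by simp [rd, hh]

lemma seg_rd_before {h : ℕ} (hh : h ≤ T.time 0) : seg (T.rd ty b) 0 h = [] :=
  seg_eq_nil fun i _ hi => T.rd_eq_nil ty b (T.eq_none_before (by omega))

lemma seg_rd_step {t h : ℕ} (h1 : T.time t < h) (h2 : h ≤ T.time (t + 1)) :
    seg (T.rd ty b) (T.time t) h = readAt T.sym T.st ty b t := by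
  rw [seg_cons _ h1, seg_eq_nil fun i hi hi' =>
    T.rd_eq_nil ty b (T.eq_none_between (t := t) (by omega) (by omega))]
  by_cases hb : ty (T.st t) = b <;> simp_all [rd, readAt, st, r_time]

lemma seg_rd (m N : ℕ) : seg (T.rd ty b) (T.time m) (T.time (m + N)) =
    seg (readAt T.sym T.st ty b) m (m + N) := by
  rw [← seg_comp _ T.time_strictMono.monotone (Nat.le_add_right m N)]
  exact seg_congr N fun i _ => T.seg_rd_step ty b (T.time_lt_succ _) le_rfl

lemma seg_rd_zero {t h : ℕ} (h1 : T.time t < h) (h2 : h ≤ T.time (t + 1)) :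
    seg (T.rd ty b) 0 h = seg (readAt T.sym T.st ty b) 0 (t + 1) := by
  have := T.seg_rd ty b 0 t
  rw [Nat.zero_add] at this
  rw [← seg_append _ (Nat.zero_le (T.time t)) h1.le, T.seg_rd_step ty b h1 h2,
    ← seg_append _ (Nat.zero_le (T.time 0)) (T.time_strictMono.monotone (Nat.zero_le t)),
    this, seg_rd_before _ _ _ le_rfl, seg_succ _ (Nat.zero_le _), List.nil_append]

lemma exists_time {h : ℕ} (hh : T.time 0 < h) : ∃ t, T.time t < h ∧ h ≤ T.time (t + 1) := by
  induction h, hh using Nat.le_induction with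
  | base => exact ⟨0, Nat.lt_succ_self _, T.time_lt_succ 0⟩
  | succ h hh ih =>
    obtain ⟨t, h1, h2⟩ := ih
    rcases h2.lt_or_eq with h3 | h3
    · exact ⟨t, by omega, h3⟩
    · exact ⟨t + 1, by omega, by rw [h3]; exact T.time_lt_succ _⟩

lemma time_le {W : ℕ} (hW : ∀ h, T.wait h ≤ W) (t : ℕ) : T.time t ≤ (W + 1) * (t + 1) := by
  induction t with
  | zero => have := hW 0; simp only [time]; omega
  | succ t ih => have := hW (T.time t + 1); rw [time_succ]; rw [Nat.mul_succ]; omega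

/-- Along a trace whose symbols form a normal word, an injective output is at least as long, in
bits, as the part of the input read at states of type `true`, and it is not much longer. -/
theorem output_bounds [Fintype A] (hA : 2 ≤ Fintype.card A) [Finite K] (hz : Normal T.sym)
    (ty : K → Bool) (hinf : ∀ t, ∃ t' ≥ t, ty (T.st t') = true)
    {d : ℕ} (hd : 2 ≤ d) (o : ℕ → List (Fin d)) (ho : ∃ B, ∀ h, (o h).length ≤ B)
    (inj : ∀ a b a' b', a ≤ b → a' ≤ b' → T.H a = T.H a' → T.H b = T.H b' →
      (T.r a).isSome → (T.r b).isSome →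
      seg (T.rd ty false) a b = seg (T.rd ty false) a' b' →
      (seg (T.rd ty true) a b).length = (seg (T.rd ty true) a' b').length →
      seg o a b = seg o a' b' → seg (T.rd ty true) a b = seg (T.rd ty true) a' b') :
    (∀ ε : ℝ, 0 < ε → ∀ᶠ h : ℕ in atTop,
      (1 - ε) * ((seg (T.rd ty true) 0 h).length * Real.log (Fintype.card A)) ≤
        (seg o 0 h).length * Real.log d) ∧
    ∃ C : ℝ, ∀ᶠ h : ℕ in atTop, ((seg o 0 h).length : ℝ) * Real.log d ≤
      C * ((seg (T.rd ty true) 0 h).length * Real.log (Fintype.card A)) := by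
  obtain ⟨δ, hδ⟩ := T.exists_next
  obtain ⟨c, hc, hcX⟩ := read_density (ty := ty) hA hz hδ hinf
  have hlk : 0 < Real.log (Fintype.card A) := Real.log_pos (by exact_mod_cast hA)
  have hld : 0 < Real.log d := Real.log_pos (by exact_mod_cast hd)
  have lift : ∀ {P : ℕ → Prop}, (∀ᶠ t in atTop, P t) →
      ∀ᶠ h in atTop, ∃ t, P t ∧ P (t + 1) ∧ 1 ≤ t ∧ T.time t < h ∧ h ≤ T.time (t + 1) := by
    intro P hP
    obtain ⟨t₀, ht₀⟩ := eventually_atTop.1 hP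
    filter_upwards [eventually_gt_atTop (T.time (t₀ + 1))] with h hh
    obtain ⟨t, h1, h2⟩ := T.exists_time
      (lt_of_le_of_lt (T.time_strictMono.monotone (Nat.zero_le _)) hh)
    have : t₀ + 1 < t + 1 := T.time_strictMono.lt_iff_lt.1 (lt_of_lt_of_le hh h2)
    exact ⟨t, ht₀ _ (by omega), ht₀ _ (by omega), by omega, h1, h2⟩
  constructor
  · intro ε hε
    have key := output_lower_bound (ty := ty) hA hz hδ hd
      (fun t => seg o (T.time t) (T.time (t + 1))) (by
        intro m m' N h1 h2 h3 h4
        rw [seg_comp o T.time_strictMono.monotone (Nat.le_add_right _ _),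
          seg_comp o T.time_strictMono.monotone (Nat.le_add_right _ _)] at h4
        have hl : (seg (readAt T.sym T.st ty true) m (m + N)).length =
            (seg (readAt T.sym T.st ty true) m' (m' + N)).length := by
          have e1 := length_readAt_add T.sym T.st ty m N
          have e2 := length_readAt_add T.sym T.st ty m' N
          rw [h3] at e1
          omega
        rw [← T.seg_rd, ← T.seg_rd] at h3 hl ⊢
        exact inj _ _ _ _ (T.time_strictMono.monotone (Nat.le_add_right _ _))
          (T.time_strictMono.monotone (Nat.le_add_right _ _)) h1 h2 (T.isSome_time _)
          (T.isSome_time _) h3 hl h4) (ε := ε * c / 2) (by positivity)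
    have hbig : ∀ᶠ t : ℕ in atTop, 1 ≤ ε * c / 2 * t := by
      filter_upwards [eventually_ge_atTop ⌈1 / (ε * c / 2)⌉₊] with n hn
      have := Nat.le_of_ceil_le hn
      rwa [div_le_iff₀ (by positivity), mul_comm] at this
    filter_upwards [lift (key.and (hcX.and hbig))] with h hh
    obtain ⟨t, ⟨h1, -, h3⟩, ⟨-, h4, -⟩, -, h5, h6⟩ := hh
    rw [seg_comp o T.time_strictMono.monotone (Nat.zero_le _)] at h1
    rw [T.seg_rd_zero ty true h5 h6]
    have e1 : ((seg o (T.time 0) (T.time t)).length : ℝ) ≤ (seg o 0 h).length := by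
      have := length_seg_mono o h5.le
      rw [← seg_append o (Nat.zero_le (T.time 0)) (T.time_strictMono.monotone (Nat.zero_le t)),
        List.length_append] at this
      exact_mod_cast (by omega)
    have e2 : ((seg (readAt T.sym T.st ty true) 0 (t + 1)).length : ℝ) ≤
        (seg (readAt T.sym T.st ty true) 0 t).length + 1 := by
      have := length_readAt_le T.sym T.st ty t 1
      rw [seg_one] at this
      rw [seg_succ _ (Nat.zero_le _), List.length_append]
      exact_mod_cast (by omega)
    set X := ((seg (readAt T.sym T.st ty true) 0 (t + 1)).length : ℝ)
    push_cast at h4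
    calc (1 - ε) * (X * Real.log (Fintype.card A)) = ((1 - ε) * X) * Real.log (Fintype.card A) :=
          by ring
      _ ≤ ((seg (readAt T.sym T.st ty true) 0 t).length - ε * c / 2 * t) *
          Real.log (Fintype.card A) := by
          refine mul_le_mul_of_nonneg_right ?_ hlk.le
          nlinarith
      _ ≤ _ := h1
      _ ≤ _ := by gcongr
  · obtain ⟨W, hW⟩ := T.wait_bounded
    obtain ⟨B, hB⟩ := ho
    refine ⟨B * ((W + 1) * 2) * Real.log d / (c * Real.log (Fintype.card A)), ?_⟩
    filter_upwards [lift hcX] with h hh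
    obtain ⟨t, -, h4, -, h5, h6⟩ := hh
    rw [T.seg_rd_zero ty true h5 h6]
    have e1 : (seg o 0 h).length ≤ B * h := by
      clear h5 h6
      induction h with
      | zero => simp
      | succ h ih =>
        rw [seg_succ _ (Nat.zero_le _), List.length_append, Nat.mul_succ]
        exact Nat.add_le_add ih (hB h)
    have e2 := T.time_le hW (t + 1)
    have e3 : ((seg o 0 h).length : ℝ) ≤ B * ((W + 1) * 2) * (t + 1 : ℕ) := by
      have : (seg o 0 h).length ≤ B * ((W + 1) * 2) * (t + 1) := by
        calc _ ≤ B * h := e1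
          _ ≤ B * ((W + 1) * (2 * (t + 1))) := by
              refine Nat.mul_le_mul_left _ (h6.trans (e2.trans (Nat.mul_le_mul_left _ (by omega))))
          _ = _ := by ring
      exact_mod_cast this
    calc _ ≤ B * ((W + 1) * 2) * (t + 1 : ℕ) * Real.log d := by gcongr
      _ = B * ((W + 1) * 2) * Real.log d / (c * Real.log (Fintype.card A)) *
          (c * (t + 1 : ℕ) * Real.log (Fintype.card A)) := by field_simp
      _ ≤ _ := by gcongr

end Trace

lemma one_le_liminf_div {u v : ℕ → ℝ} (hv : ∀ᶠ n in atTop, 0 < v n)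
    (h1 : ∀ ε : ℝ, 0 < ε → ∀ᶠ n in atTop, (1 - ε) * v n ≤ u n)
    (h2 : ∃ C : ℝ, ∀ᶠ n in atTop, u n ≤ C * v n) :
    1 ≤ liminf (fun n => u n / v n) atTop := by
  obtain ⟨C, hC⟩ := h2
  have hbdd : IsCoboundedUnder (· ≥ ·) atTop (fun n => u n / v n) := by
    refine IsBoundedUnder.isCoboundedUnder_ge ⟨C, ?_⟩
    rw [eventually_map]
    filter_upwards [hv, hC] with n hn hc
    exact (div_le_iff₀ hn).2 hc
  refine le_of_forall_pos_le_add fun ε hε => ?_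
  have := le_liminf_of_le hbdd (a := 1 - ε) (by
    filter_upwards [hv, h1 ε hε] with n hn hc
    exact (le_div_iff₀ hn).2 hc)
  linarith

lemma bounded_of_factor {K : Type*} [Finite K] (f : ℕ → K) (g : ℕ → ℕ)
    (h : ∀ i j, f i = f j → g i = g j) : ∃ M, ∀ i, g i ≤ M := by
  classical
  have hfin : (Set.range g).Finite := by
    refine (Set.finite_range fun q : K => if h : ∃ n, f n = q then g h.choose else 0).subset ?_
    rintro _ ⟨i, rfl⟩
    refine ⟨f i, ?_⟩
    have hex : ∃ n, f n = f i := ⟨i, rfl⟩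
    simp only [hex, dif_pos]
    exact h _ _ hex.choose_spec
  obtain ⟨M, hM⟩ := hfin.bddAbove
  exact ⟨M, fun i => hM ⟨i, rfl⟩⟩

lemma exists_isSome_of_tendsto {α : Type*} {f : ℕ → Option α}
    (h : Tendsto (fun n => (seg (fun i => (f i).toList) 0 n).length) atTop atTop) (N : ℕ) :
    ∃ n ≥ N, (f n).isSome := by
  by_contra! hcon
  obtain ⟨n, h1, h2⟩ := ((tendsto_atTop.1 h ((seg (fun i => (f i).toList) 0 N).length + 1)).and
    (eventually_ge_atTop N)).exists
  rw [← seg_append _ (Nat.zero_le N) h2, seg_eq_nil (a := N) fun i hi _ => ?_] at h1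
  · simp at h1
  · have := hcon i hi
    simpa using this

namespace Trace
variable {K : Type*} (T : Trace K A)

lemma exists_time_eq {h : ℕ} (hh : (T.r h).isSome) : ∃ t, T.time t = h := by
  rcases lt_trichotomy h (T.time 0) with h1 | h1 | h1
  · simp [T.eq_none_before h1] at hh
  · exact ⟨0, h1.symm⟩
  · obtain ⟨t, h2, h3⟩ := T.exists_time h1
    rcases h3.lt_or_eq with h4 | h4
    · simp [T.eq_none_between h2 h4] at hh
    · exact ⟨t + 1, h4.symm⟩

lemma frequently_type {ty : K → Bool}
    (h : ∀ N, ∃ h ≥ N, ty (T.H h) = true ∧ (T.r h).isSome) (t : ℕ) :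
    ∃ t' ≥ t, ty (T.st t') = true := by
  obtain ⟨h, h1, h2, h3⟩ := h (T.time t)
  obtain ⟨t', rfl⟩ := T.exists_time_eq h3
  exact ⟨t', T.time_strictMono.le_iff_le.1 h1, h2⟩

lemma readAt_eq_pref {ty : K → Bool} {b : Bool} {x : ℕ → A}
    (h : ∀ n, seg (T.rd ty b) 0 n = pref x (seg (T.rd ty b) 0 n).length) (t : ℕ) :
    seg (readAt T.sym T.st ty b) 0 t = pref x (seg (readAt T.sym T.st ty b) 0 t).length := by
  cases t with
  | zero => simp [pref]
  | succ t =>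
    rw [← T.seg_rd_zero ty b (T.time_lt_succ t) le_rfl]
    exact h _

end Trace

lemma eq_of_pref_append {x : ℕ → A} {a : A} {n : ℕ} (h : pref x n ++ [a] = pref x (n + 1)) :
    x n = a := by
  rw [pref_eq_seg, pref_eq_seg, seg_succ _ (Nat.zero_le _)] at h
  simpa using (List.append_cancel_left h).symm

lemma readAt_symbol {K : Type*} {z : ℕ → A} {s : ℕ → K} {ty : K → Bool} {b : Bool} {x : ℕ → A}
    (h : ∀ t, seg (readAt z s ty b) 0 t = pref x (seg (readAt z s ty b) 0 t).length) {t : ℕ}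
    (ht : ty (s t) = b) : x (seg (readAt z s ty b) 0 t).length = z t := by
  have h1 := h (t + 1)
  rw [seg_succ _ (Nat.zero_le _), h t] at h1
  simp only [readAt, ht, if_true, List.length_append, List.length_singleton, length_pref] at h1
  exact eq_of_pref_append h1

/-- A finite-state run reading `x` and `y` is the run of a shuffler. -/
lemma exists_shuffler {K : Type*} [Finite K] {z : ℕ → A} {s : ℕ → K} {ty : K → Bool}
    {δ : K → A → K} {x y : ℕ → A} (hs : ∀ t, s (t + 1) = δ (s t) (z t))
    (hx : ∀ t, seg (readAt z s ty true) 0 t = pref x (seg (readAt z s ty true) 0 t).length)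
    (hy : ∀ t, seg (readAt z s ty false) 0 t = pref y (seg (readAt z s ty false) 0 t).length) :
    ∃ S : Shuffler A, S.out x y = z := by
  have e := Finite.equivFin K
  let S : Shuffler A := ⟨Nat.card K, e (s 0), fun q => ty (e.symm q), fun q a => e (δ (e.symm q) a)⟩
  have hcfg : ∀ t, S.cfg x y t = (e (s t), (seg (readAt z s ty true) 0 t).length,
      (seg (readAt z s ty false) 0 t).length) := by
    intro t
    induction t with
    | zero => simp [Shuffler.cfg, S]
    | succ t ih =>
      rw [Shuffler.cfg, ih, seg_succ _ (Nat.zero_le _), seg_succ _ (Nat.zero_le _)]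
      cases hty : ty (s t) with
      | true => simp [S, hty, readAt_symbol hx hty, hs, readAt]
      | false => simp [S, hty, readAt_symbol hy hty, hs, readAt]
  refine ⟨S, funext fun t => ?_⟩
  simp only [Shuffler.out, hcfg]
  cases hty : ty (s t) with
  | true => simp [S, hty, readAt_symbol hx hty]
  | false => simp [S, hty, readAt_symbol hy hty]

section Rho
variable {m d : ℕ}

lemma c2in_eq (γ : ℕ → Q × Option A × List D × Q) (n : ℕ) :
    c2in γ n = seg (fun i => (γ i).2.1.toList) 0 n := reduceOption_map_range _ n

lemma c2out_eq (γ : ℕ → Q × Option A × List D × Q) (n : ℕ) :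
    c2out γ n = seg (fun i => (γ i).2.2.1) 0 n := flatten_map_range _ n

/-- Replacing a segment of an accepting run by another one with the same output and with an
input of the same length does not change the input. -/
lemma Comp2.OneToOne.seg_eq {C : Comp2 A D Q} (hC : C.OneToOne)
    {γ : ℕ → Q × Option A × List D × Q} {x : ℕ → A} (hγ : C.IsAccRunOn γ x) {n n₁ n' n₁' : ℕ}
    (h1 : n ≤ n₁) (h2 : n' ≤ n₁') (h3 : (γ n).1 = (γ n').1) (h4 : (γ n₁).1 = (γ n₁').1)
    (h5 : (seg (fun i => (γ i).2.1.toList) n n₁).length =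
      (seg (fun i => (γ i).2.1.toList) n' n₁').length)
    (h6 : seg (fun i => (γ i).2.2.1) n n₁ = seg (fun i => (γ i).2.2.1) n' n₁') :
    seg (fun i => (γ i).2.1.toList) n n₁ = seg (fun i => (γ i).2.1.toList) n' n₁' := by
  obtain ⟨g0, gt, gc, gi, gti, gto⟩ := hγ
  simp only [c2in_eq] at gi gti
  simp only [c2out_eq] at gto
  have hti := tendsto_seg_splice (n := n) (n₁ := n₁) γ (fun τ => τ.2.1.toList) h2 gti
  obtain ⟨x', hx'⟩ := exists_limit _ hti
  have hout := seg_splice_of_eq γ (fun τ => τ.2.2.1) h2 h1 h6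
  have hrun' : C.IsAccRunOn (splice γ n n' n₁' n₁) x' := by
    refine ⟨?_, fun i => ?_, splice_chain (src := Prod.fst) (tgt := fun τ => τ.2.2.2) gc h2 h3 h4,
      fun i => ?_, ?_, ?_⟩
    · rw [← g0]; exact splice_src_zero (src := Prod.fst) h2 h3 h4
    · obtain ⟨j, hj⟩ := splice_eq_some γ n n' n₁' n₁ i
      rw [hj]; exact gt j
    · simp only [c2in_eq]; exact hx' i
    · simp only [c2in_eq]; exact hti
    · simp only [c2out_eq]; exact tendsto_seg_splice γ (fun τ => τ.2.2.1) h2 gto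
  have hxx : x = x' := by
    refine hC x x' γ _ ⟨g0, gt, gc, by simpa only [c2in_eq] using gi,
      by simpa only [c2in_eq] using gti, by simpa only [c2out_eq] using gto⟩ hrun' ?_ ?_
    · intro i
      refine ⟨n + (n₁' - n') + i, ?_⟩
      rw [c2out_eq, c2out_eq, hout]
      exact seg_zero_prefix _ (by omega)
    · intro i
      refine ⟨n₁ + i, ?_⟩
      rw [c2out_eq, c2out_eq, ← hout]
      exact seg_zero_prefix _ (by omega)
  have e1 := gi n₁
  have e2 := hx' (n + (n₁' - n') + 0)
  rw [seg_splice γ (fun τ => τ.2.1.toList) h2] at e2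
  rw [← seg_append _ (Nat.zero_le n) h1] at e1
  simp only [Nat.add_zero, seg_self, List.append_nil] at e2
  rw [← hxx, List.length_append, ← h5, ← List.length_append, ← e1] at e2
  exact (List.append_cancel_left e2).symm

variable [Fintype A]

/-- Normal words are incompressible. -/
theorem Comp2.one_le_ratio (hA : 2 ≤ Fintype.card A) {x : ℕ → A} (hx : Normal x) (hd : 2 ≤ d)
    {C : Comp2 A (Fin d) (Fin m)} (hdet : C.OneDet) (hone : C.OneToOne)
    {γ : ℕ → Fin m × Option A × List (Fin d) × Fin m} (hγ : C.IsAccRunOn γ x) :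
    1 ≤ liminf (fun n : ℕ => (((c2out γ n).length : ℝ) * Real.log d) /
      (((c2in γ n).length : ℝ) * Real.log (Fintype.card A))) atTop := by
  obtain ⟨g0, gt, gc, gi, gti, gto⟩ := id hγ
  simp only [c2in_eq] at gi gti ⊢
  simp only [c2out_eq] at gto ⊢
  have hdet' := fun i j => hdet _ (gt i) _ (gt j)
  let T : Trace (Fin m) A :=
    { H := fun h => (γ h).1
      r := fun h => (γ h).2.1
      inf := fun h => by
        obtain ⟨n, hn, h1⟩ := exists_isSome_of_tendsto gti h
        obtain ⟨i, rfl⟩ := Nat.exists_eq_add_of_le hn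
        exact ⟨i, h1⟩
      isSome_eq := fun h h' he => (hdet' h h' he).1
      succ_eq := fun h h' he hr => by rw [← gc, ← gc, (hdet' h h' he).2 hr] }
  have hrd : T.rd (fun _ => true) true = fun i => (γ i).2.1.toList := by
    funext i; simp [Trace.rd, T]
  have hsym : x = T.sym := by
    have h1 := T.readAt_eq_pref (ty := fun _ => true) (b := true) (x := x) (by rw [hrd]; exact gi)
    have h2 : ∀ t, seg (readAt T.sym T.st (fun _ => true) true) 0 t = pref T.sym t := by
      intro t; rw [pref_eq_seg]; congr 1
    funext t
    have := readAt_symbol h1 (t := t) rfl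
    rwa [h2, length_pref] at this
  obtain ⟨hlow, hup⟩ := T.output_bounds hA (by rwa [← hsym]) (fun _ => true)
    (fun t => ⟨t, le_rfl, rfl⟩) hd (fun h => (γ h).2.2.1)
    (bounded_of_factor (fun h => ((γ h).1, (γ h).2.1)) _ fun i j hij => by
      obtain ⟨h1, h2⟩ := Prod.ext_iff.1 hij
      rw [(hdet' i j h1).2 h2])
    (by
      intro a b a' b' h1 h2 h3 h4 _ _ _ h5 h6
      rw [hrd] at h5 ⊢
      exact hone.seg_eq hγ h1 h2 h3 h4 h5 h6)
  rw [hrd] at hlow hup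
  refine one_le_liminf_div ?_ hlow hup
  filter_upwards [tendsto_atTop.1 gti 1] with n hn
  exact mul_pos (by exact_mod_cast hn) (Real.log_pos (by exact_mod_cast hA))

end Rho

section Half
variable {α : Type*}

/-- The sequence `f₀ 0, f₁ 0, f₀ 1, f₁ 1, …`. -/
def half (f₀ f₁ : ℕ → α) (h : ℕ) : α := if h % 2 = 0 then f₀ (h / 2) else f₁ (h / 2)

@[simp] lemma half_even (f₀ f₁ : ℕ → α) (n : ℕ) : half f₀ f₁ (2 * n) = f₀ n := by
  simp [half]

@[simp] lemma half_odd (f₀ f₁ : ℕ → α) (n : ℕ) : half f₀ f₁ (2 * n + 1) = f₁ n := by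
  simp [half, show (2 * n + 1) / 2 = n by omega, Nat.add_mod]

lemma even_or_odd_cases {P : ℕ → Prop} (h₀ : ∀ n, P (2 * n)) (h₁ : ∀ n, P (2 * n + 1)) (h : ℕ) :
    P h := by
  rcases Nat.even_or_odd' h with ⟨n, rfl | rfl⟩
  exacts [h₀ n, h₁ n]

lemma seg_half_right (f : ℕ → List α) {a b : ℕ} (h : a ≤ b) :
    seg (half (fun _ => []) f) a b = seg f (a / 2) (b / 2) := by
  induction b, h using Nat.le_induction with
  | base => simp
  | succ b hab ih =>
    rw [seg_succ _ hab, ih]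
    obtain ⟨n, rfl | rfl⟩ := Nat.even_or_odd' b
    · rw [half_even, List.append_nil]
      congr 1; omega
    · rw [half_odd, show (2 * n + 1 + 1) / 2 = n + 1 by omega, seg_succ _ (by omega)]
      congr 2; omega

lemma seg_half_left (f : ℕ → List α) {a b : ℕ} (h : a ≤ b) :
    half (fun _ => []) f a ++ seg (half f fun _ => []) a b =
      seg f (a / 2) (b / 2) ++ half (fun _ => []) f b := by
  induction b, h using Nat.le_induction with
  | base => simp
  | succ b hab ih =>
    rw [seg_succ _ hab, ← List.append_assoc, ih]
    obtain ⟨n, rfl | rfl⟩ := Nat.even_or_odd' b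
    · rw [half_even, half_even, half_odd, List.append_nil]
      congr 2; omega
    · rw [half_odd, half_odd, show 2 * n + 1 + 1 = 2 * (n + 1) by ring, half_even,
        List.append_nil, List.append_nil, show 2 * (n + 1) / 2 = n + 1 by omega,
        seg_succ _ (by omega)]
      congr 2; omega

end Half

section CondRho
variable {m d : ℕ}

lemma c3in1_eq (γ : ℕ → Q × (Option A × Option B) × List D × Q) (n : ℕ) :
    c3in1 γ n = seg (fun i => (γ i).2.1.1.toList) 0 n := reduceOption_map_range _ n

lemma c3in2_eq (γ : ℕ → Q × (Option A × Option B) × List D × Q) (n : ℕ) :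
    c3in2 γ n = seg (fun i => (γ i).2.1.2.toList) 0 n := reduceOption_map_range _ n

lemma c3out_eq (γ : ℕ → Q × (Option A × Option B) × List D × Q) (n : ℕ) :
    c3out γ n = seg (fun i => (γ i).2.2.1) 0 n := flatten_map_range _ n

/-- Replacing a segment of an accepting run by another one with the same output, the same
second input and a first input of the same length does not change the first input. -/
lemma Comp3.OneToOne.seg_eq {C : Comp3 A B D Q} (hC : C.OneToOne)
    {γ : ℕ → Q × (Option A × Option B) × List D × Q} {x : ℕ → A} {y : ℕ → B}
    (hγ : C.IsAccRunOn γ x y) {n n₁ n' n₁' : ℕ}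
    (h1 : n ≤ n₁) (h2 : n' ≤ n₁') (h3 : (γ n).1 = (γ n').1) (h4 : (γ n₁).1 = (γ n₁').1)
    (h5 : (seg (fun i => (γ i).2.1.1.toList) n n₁).length =
      (seg (fun i => (γ i).2.1.1.toList) n' n₁').length)
    (h7 : seg (fun i => (γ i).2.1.2.toList) n n₁ = seg (fun i => (γ i).2.1.2.toList) n' n₁')
    (h6 : seg (fun i => (γ i).2.2.1) n n₁ = seg (fun i => (γ i).2.2.1) n' n₁') :
    seg (fun i => (γ i).2.1.1.toList) n n₁ = seg (fun i => (γ i).2.1.1.toList) n' n₁' := by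
  obtain ⟨g0, gt, gc, gi, gj, gti, gtj, gto⟩ := id hγ
  simp only [c3in1_eq] at gi gti
  simp only [c3in2_eq] at gj gtj
  simp only [c3out_eq] at gto
  have hti := tendsto_seg_splice (n := n) (n₁ := n₁) γ (fun τ => τ.2.1.1.toList) h2 gti
  obtain ⟨x', hx'⟩ := exists_limit _ hti
  have hout := seg_splice_of_eq γ (fun τ => τ.2.2.1) h2 h1 h6
  have hin2 := seg_splice_of_eq γ (fun τ => τ.2.1.2.toList) h2 h1 h7
  have hrun' : C.IsAccRunOn (splice γ n n' n₁' n₁) x' y := by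
    refine ⟨?_, fun i => ?_, splice_chain (src := Prod.fst) (tgt := fun τ => τ.2.2.2) gc h2 h3 h4,
      fun i => ?_, fun i => ?_, ?_, ?_, ?_⟩
    · rw [← g0]; exact splice_src_zero (src := Prod.fst) h2 h3 h4
    · obtain ⟨j, hj⟩ := splice_eq_some γ n n' n₁' n₁ i
      rw [hj]; exact gt j
    · simp only [c3in1_eq]; exact hx' i
    · simp only [c3in2_eq]
      refine eq_pref_of_prefix (n := (seg (fun i => (γ i).2.1.2.toList) 0 (n₁ + i)).length) ?_
      rw [← gj, ← hin2]
      exact seg_zero_prefix _ (by omega)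
    · simp only [c3in1_eq]; exact hti
    · simp only [c3in2_eq]; exact tendsto_seg_splice γ (fun τ => τ.2.1.2.toList) h2 gtj
    · simp only [c3out_eq]; exact tendsto_seg_splice γ (fun τ => τ.2.2.1) h2 gto
  have hxx : x = x' := by
    refine hC x x' y γ _ hγ hrun' ?_ ?_
    · intro i
      refine ⟨n + (n₁' - n') + i, ?_⟩
      rw [c3out_eq, c3out_eq, hout]
      exact seg_zero_prefix _ (by omega)
    · intro i
      refine ⟨n₁ + i, ?_⟩
      rw [c3out_eq, c3out_eq, ← hout]
      exact seg_zero_prefix _ (by omega)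
  have e1 := gi n₁
  have e2 := hx' (n + (n₁' - n') + 0)
  rw [seg_splice γ (fun τ => τ.2.1.1.toList) h2] at e2
  rw [← seg_append _ (Nat.zero_le n) h1] at e1
  simp only [Nat.add_zero, seg_self, List.append_nil] at e2
  rw [← hxx, List.length_append, ← h5, ← List.length_append, ← e1] at e2
  exact (List.append_cancel_left e2).symm

variable [Fintype A]

/-- If all shufflings of `x` and `y` are normal then `x` is incompressible given `y`. -/
theorem Comp3.one_le_ratio (hA : 2 ≤ Fintype.card A) {x y : ℕ → A}
    (hxy : ∀ S : Shuffler A, Normal (S.out x y)) (hd : 2 ≤ d)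
    {C : Comp3 A A (Fin d) (Fin m)} (hdet : C.TwoDet) (hone : C.OneToOne)
    {γ : ℕ → Fin m × (Option A × Option A) × List (Fin d) × Fin m} (hγ : C.IsAccRunOn γ x y) :
    1 ≤ liminf (fun n : ℕ => (((c3out γ n).length : ℝ) * Real.log d) /
      (((c3in1 γ n).length : ℝ) * Real.log (Fintype.card A))) atTop := by
  obtain ⟨g0, gt, gc, gi, gj, gti, gtj, gto⟩ := id hγ
  simp only [c3in1_eq] at gi gti ⊢
  simp only [c3in2_eq] at gj gtj
  simp only [c3out_eq] at gto ⊢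
  have hdet' := fun i j => hdet _ (gt i) _ (gt j)
  let T : Trace (Fin m × Option (Option A)) A :=
    { H := half (fun n => ((γ n).1, none)) (fun n => ((γ n).1, some (γ n).2.1.1))
      r := half (fun n => (γ n).2.1.1) (fun n => (γ n).2.1.2)
      inf := fun h => by
        obtain ⟨n, hn, h1⟩ := exists_isSome_of_tendsto gti h
        obtain ⟨i, hi⟩ := Nat.exists_eq_add_of_le (show h ≤ 2 * n by omega)
        exact ⟨i, by rw [← hi, half_even]; exact h1⟩
      isSome_eq := even_or_odd_cases
        (fun n => even_or_odd_cases
          (fun n' he => by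
            simp only [half_even, Prod.mk.injEq, and_true] at he ⊢
            exact congrArg Prod.fst (hdet' _ _ he).1)
          (fun n' he => by simp at he))
        (fun n => even_or_odd_cases
          (fun n' he => by simp at he)
          (fun n' he => by
            simp only [half_odd, Prod.mk.injEq] at he ⊢
            exact congrArg Prod.snd (hdet' _ _ he.1).1))
      succ_eq := even_or_odd_cases
        (fun n => even_or_odd_cases
          (fun n' he hr => by
            simp only [half_even, half_odd, Prod.mk.injEq, and_true] at he hr ⊢
            exact ⟨he, congrArg some hr⟩)
          (fun n' he => by simp at he))
        (fun n => even_or_odd_cases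
          (fun n' he => by simp at he)
          (fun n' he hr => by
            simp only [half_odd, Prod.mk.injEq, Option.some.injEq] at he hr
            rw [show 2 * n + 1 + 1 = 2 * (n + 1) by ring,
              show 2 * n' + 1 + 1 = 2 * (n' + 1) by ring, half_even, half_even, ← gc, ← gc,
              (hdet' _ _ he.1).2 (Prod.ext he.2 hr)])) }
  let ty : Fin m × Option (Option A) → Bool := fun q => q.2.isNone
  have hrdt : T.rd ty true = half (fun i => (γ i).2.1.1.toList) fun _ => [] := by
    funext h
    obtain ⟨n, rfl | rfl⟩ := Nat.even_or_odd' h <;> simp [Trace.rd, T, ty]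
  have hrdf : T.rd ty false = half (fun _ => []) fun i => (γ i).2.1.2.toList := by
    funext h
    obtain ⟨n, rfl | rfl⟩ := Nat.even_or_odd' h <;> simp [Trace.rd, T, ty]
  have hrdt0 : ∀ n, seg (T.rd ty true) 0 (2 * n) = seg (fun i => (γ i).2.1.1.toList) 0 n := by
    intro n
    have := seg_half_left (fun i => (γ i).2.1.1.toList) (Nat.zero_le (2 * n))
    rw [hrdt]
    simpa [half] using this
  have hrdf0 : ∀ n, seg (T.rd ty false) 0 (2 * n) = seg (fun i => (γ i).2.1.2.toList) 0 n := by
    intro n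
    rw [hrdf, seg_half_right _ (Nat.zero_le _)]
    congr 1; omega
  have hx := T.readAt_eq_pref (ty := ty) (b := true) (x := x) fun n => by
    refine eq_pref_of_prefix (n := (seg (T.rd ty true) 0 (2 * n)).length) ?_
    have := gi n
    rw [← hrdt0] at this
    rw [← this]
    exact seg_zero_prefix _ (by omega)
  have hy := T.readAt_eq_pref (ty := ty) (b := false) (x := y) fun n => by
    refine eq_pref_of_prefix (n := (seg (T.rd ty false) 0 (2 * n)).length) ?_
    have := gj n
    rw [← hrdf0] at this
    rw [← this]
    exact seg_zero_prefix _ (by omega)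
  obtain ⟨δ, hδ⟩ := T.exists_next
  obtain ⟨S, hS⟩ := exists_shuffler hδ hx hy
  have hfreq := T.frequently_type (ty := ty) fun N => by
    obtain ⟨n, hn, h1⟩ := exists_isSome_of_tendsto gti N
    exact ⟨2 * n, by omega, by simp [T, ty], by simpa [T] using h1⟩
  obtain ⟨hlow, hup⟩ := T.output_bounds hA (hS ▸ hxy S) ty hfreq hd
    (half (fun _ => []) fun i => (γ i).2.2.1) (by
      obtain ⟨M, hM⟩ := bounded_of_factor (fun h => ((γ h).1, (γ h).2.1))
        (fun h => (γ h).2.2.1.length) fun i j hij => by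
          obtain ⟨h1, h2⟩ := Prod.ext_iff.1 hij
          rw [(hdet' i j h1).2 h2]
      refine ⟨M, even_or_odd_cases (fun n => by simp) (fun n => by simpa using hM n)⟩)
    (by
      intro a b a' b' h1 h2 h3 h4 _ _ h5 h6 h7
      have hstate : ∀ {i j}, T.H i = T.H j → (γ (i / 2)).1 = (γ (j / 2)).1 := by
        intro i j hij
        have := congrArg Prod.fst hij
        simp only [T, half] at this
        split_ifs at this <;> exact this
      have hedge : ∀ {i j}, T.H i = T.H j →
          half (fun _ => []) (fun n => (γ n).2.1.1.toList) i =
          half (fun _ => []) (fun n => (γ n).2.1.1.toList) j := by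
        intro i j hij
        have := congrArg (fun q => q.2.elim [] Option.toList) hij
        simp only [T, half] at this ⊢
        split_ifs at this ⊢ <;> exact this
      rw [hrdf, seg_half_right _ h1, seg_half_right _ h2] at h5
      rw [seg_half_right _ h1, seg_half_right _ h2] at h7
      rw [hrdt] at h6 ⊢
      have e1 := seg_half_left (fun i => (γ i).2.1.1.toList) h1
      have e2 := seg_half_left (fun i => (γ i).2.1.1.toList) h2
      rw [← hedge h3, ← hedge h4] at e2
      have hlen := hone.seg_eq hγ (Nat.div_le_div_right h1) (Nat.div_le_div_right h2)
        (hstate h3) (hstate h4) (by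
          have l1 := congrArg List.length e1
          have l2 := congrArg List.length e2
          simp only [List.length_append] at l1 l2
          omega) h5 h7
      rw [← hlen, ← e1] at e2
      exact (List.append_cancel_left e2).symm)
  have h2 : Tendsto (fun n : ℕ => 2 * n) atTop atTop :=
    tendsto_atTop_mono (fun n => by simp only [id]; omega) tendsto_id
  have hout : ∀ n, seg (half (fun _ => []) fun i => (γ i).2.2.1) 0 (2 * n) =
      seg (fun i => (γ i).2.2.1) 0 n := by
    intro n
    rw [seg_half_right _ (Nat.zero_le _)]
    congr 1; omega
  refine one_le_liminf_div ?_ (fun ε hε => ?_) ?_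
  · filter_upwards [tendsto_atTop.1 gti 1] with n hn
    exact mul_pos (by exact_mod_cast hn) (Real.log_pos (by exact_mod_cast hA))
  · simpa only [hout, hrdt0] using h2.eventually (hlow ε hε)
  · obtain ⟨M, hM⟩ := hup
    exact ⟨M, by simpa only [hout, hrdt0] using h2.eventually hM⟩

end CondRho

section Values
variable [Fintype A]

lemma liminf_copy_ratio (hA : 2 ≤ Fintype.card A) :
    liminf (fun n : ℕ => ((n : ℝ) * Real.log (Fintype.card A)) /
      ((n : ℝ) * Real.log (Fintype.card A))) atTop = 1 := by
  have hlk : 0 < Real.log (Fintype.card A) := Real.log_pos (by exact_mod_cast hA)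
  refine (Tendsto.congr' ?_ tendsto_const_nhds).liminf_eq
  filter_upwards [eventually_gt_atTop 0] with n hn
  have : (0 : ℝ) < n := by exact_mod_cast hn
  rw [div_self (by positivity)]

/-- The machine that copies its input. -/
noncomputable def copyComp2 (A : Type*) [Fintype A] : Comp2 A (Fin (Fintype.card A)) (Fin 1) where
  init := 0
  trans := {t | ∃ a, t = (0, some a, [Fintype.equivFin A a], 0)}

/-- The machine that copies its first input and ignores the second one. -/
noncomputable def copyComp3 (A : Type*) [Fintype A] :
    Comp3 A A (Fin (Fintype.card A)) (Fin 1) where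
  init := 0
  trans := {t | ∃ a b, t = (0, (some a, some b), [Fintype.equivFin A a], 0)}

lemma eq_of_out_prefix {x x' : ℕ → A} {f f' : ℕ → List (Fin (Fintype.card A))}
    (hf : ∀ n, f n = pref (fun i => Fintype.equivFin A (x i)) n)
    (hf' : ∀ n, f' n = pref (fun i => Fintype.equivFin A (x' i)) n)
    (h : ∀ n, ∃ m, f n <+: f' m) : x = x' := by
  have : (fun i => Fintype.equivFin A (x i)) = fun i => Fintype.equivFin A (x' i) := by
    refine eq_of_pref_eq fun n => ⟨n, le_rfl, ?_⟩
    obtain ⟨m, hm⟩ := h n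
    rw [hf, hf'] at hm
    simpa [length_pref] using eq_pref_of_prefix hm
  funext i
  exact (Fintype.equivFin A).injective (congrFun this i)

theorem rho_eq_one (hA : 2 ≤ Fintype.card A) {x : ℕ → A} (hx : Normal x) : rho x = 1 := by
  have hmem : (1 : ℝ) ∈ {r : ℝ | ∃ (m d : ℕ), 2 ≤ d ∧ ∃ C : Comp2 A (Fin d) (Fin m),
      C.OneDet ∧ C.OneToOne ∧ ∃ γ, C.IsAccRunOn γ x ∧
      r = Filter.liminf (fun n : ℕ => (((c2out γ n).length : ℝ) * Real.log d) /
        (((c2in γ n).length : ℝ) * Real.log (Fintype.card A))) atTop} := by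
    have hin : ∀ n, c2in (fun i => ((0 : Fin 1), some (x i), [Fintype.equivFin A (x i)],
        (0 : Fin 1))) n = pref x n := by
      intro n; rw [c2in_eq, pref_eq_seg]; rfl
    have hout : ∀ n, c2out (fun i => ((0 : Fin 1), some (x i), [Fintype.equivFin A (x i)],
        (0 : Fin 1))) n = pref (fun i => Fintype.equivFin A (x i)) n := by
      intro n; rw [c2out_eq, pref_eq_seg]
    refine ⟨1, Fintype.card A, hA, copyComp2 A, ?_, ?_, _, ⟨rfl, fun n => ⟨x n, rfl⟩, fun n => rfl,
      fun n => ?_, ?_, ?_⟩, ?_⟩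
    · rintro _ ⟨a, rfl⟩ _ ⟨a', rfl⟩ -
      simp
    · have key : ∀ (x : ℕ → A) γ, (copyComp2 A).IsAccRunOn γ x →
          ∀ n, c2out γ n = pref (fun i => Fintype.equivFin A (x i)) n := by
        intro x γ hγ n
        choose a ha using hγ.2.1
        have h1 : ∀ n, c2in γ n = pref a n := by
          intro n; rw [c2in_eq, pref_eq_seg]; simp only [ha]; rfl
        have h2 : a = x := eq_of_pref_eq fun n => ⟨n, le_rfl, by
          have := hγ.2.2.2.1 n
          rwa [h1, length_pref] at this⟩
        rw [c2out_eq, pref_eq_seg]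
        simp only [ha, h2]
      intro x x' γ γ' hγ hγ' h1 _
      exact eq_of_out_prefix (key x γ hγ) (key x' γ' hγ') h1
    · rw [hin, length_pref]
    · simp only [hin, length_pref]; exact tendsto_id
    · simp only [hout, length_pref]; exact tendsto_id
    · simp only [hin, hout, length_pref]; exact (liminf_copy_ratio hA).symm
  have hle : ∀ r ∈ {r : ℝ | ∃ (m d : ℕ), 2 ≤ d ∧ ∃ C : Comp2 A (Fin d) (Fin m),
      C.OneDet ∧ C.OneToOne ∧ ∃ γ, C.IsAccRunOn γ x ∧
      r = Filter.liminf (fun n : ℕ => (((c2out γ n).length : ℝ) * Real.log d) /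
        (((c2in γ n).length : ℝ) * Real.log (Fintype.card A))) atTop}, 1 ≤ r := by
    rintro _ ⟨m, d, hd, C, hdet, hone, γ, hγ, rfl⟩
    exact Comp2.one_le_ratio hA hx hd hdet hone hγ
  exact le_antisymm (csInf_le ⟨1, hle⟩ hmem) (le_csInf ⟨1, hmem⟩ hle)

theorem condRho_eq_one (hA : 2 ≤ Fintype.card A) {x y : ℕ → A}
    (hxy : ∀ S : Shuffler A, Normal (S.out x y)) : condRho x y = 1 := by
  have hmem : (1 : ℝ) ∈ {r : ℝ | ∃ (m d : ℕ), 2 ≤ d ∧ ∃ C : Comp3 A A (Fin d) (Fin m),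
      C.TwoDet ∧ C.OneToOne ∧ ∃ γ, C.IsAccRunOn γ x y ∧
      r = Filter.liminf (fun n : ℕ => (((c3out γ n).length : ℝ) * Real.log d) /
        (((c3in1 γ n).length : ℝ) * Real.log (Fintype.card A))) atTop} := by
    have hin : ∀ n, c3in1 (fun i => ((0 : Fin 1), (some (x i), some (y i)),
        [Fintype.equivFin A (x i)], (0 : Fin 1))) n = pref x n := by
      intro n; rw [c3in1_eq, pref_eq_seg]; rfl
    have hin2 : ∀ n, c3in2 (fun i => ((0 : Fin 1), (some (x i), some (y i)),
        [Fintype.equivFin A (x i)], (0 : Fin 1))) n = pref y n := by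
      intro n; rw [c3in2_eq, pref_eq_seg]; rfl
    have hout : ∀ n, c3out (fun i => ((0 : Fin 1), (some (x i), some (y i)),
        [Fintype.equivFin A (x i)], (0 : Fin 1))) n =
        pref (fun i => Fintype.equivFin A (x i)) n := by
      intro n; rw [c3out_eq, pref_eq_seg]
    refine ⟨1, Fintype.card A, hA, copyComp3 A, ?_, ?_, _, ⟨rfl, fun n => ⟨x n, y n, rfl⟩,
      fun n => rfl, fun n => ?_, fun n => ?_, ?_, ?_, ?_⟩, ?_⟩
    · rintro _ ⟨a, b, rfl⟩ _ ⟨a', b', rfl⟩ -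
      simp only [lsupp, Option.isSome_some, true_and, Prod.mk.injEq, Option.some.injEq]
      rintro ⟨rfl, rfl⟩
      simp
    · have key : ∀ (x y : ℕ → A) γ, (copyComp3 A).IsAccRunOn γ x y →
          ∀ n, c3out γ n = pref (fun i => Fintype.equivFin A (x i)) n := by
        intro x y γ hγ n
        choose a b ha using hγ.2.1
        have h1 : ∀ n, c3in1 γ n = pref a n := by
          intro n; rw [c3in1_eq, pref_eq_seg]; simp only [ha]; rfl
        have h2 : a = x := eq_of_pref_eq fun n => ⟨n, le_rfl, by
          have := hγ.2.2.2.1 n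
          rwa [h1, length_pref] at this⟩
        rw [c3out_eq, pref_eq_seg]
        simp only [ha, h2]
      intro x x' y γ γ' hγ hγ' h1 _
      exact eq_of_out_prefix (key x y γ hγ) (key x' y γ' hγ') h1
    · rw [hin, length_pref]
    · rw [hin2, length_pref]
    · simp only [hin, length_pref]; exact tendsto_id
    · simp only [hin2, length_pref]; exact tendsto_id
    · simp only [hout, length_pref]; exact tendsto_id
    · simp only [hin, hout, length_pref]; exact (liminf_copy_ratio hA).symm
  have hle : ∀ r ∈ {r : ℝ | ∃ (m d : ℕ), 2 ≤ d ∧ ∃ C : Comp3 A A (Fin d) (Fin m),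
      C.TwoDet ∧ C.OneToOne ∧ ∃ γ, C.IsAccRunOn γ x y ∧
      r = Filter.liminf (fun n : ℕ => (((c3out γ n).length : ℝ) * Real.log d) /
        (((c3in1 γ n).length : ℝ) * Real.log (Fintype.card A))) atTop}, 1 ≤ r := by
    rintro _ ⟨m, d, hd, C, hdet, hone, γ, hγ, rfl⟩
    exact Comp3.one_le_ratio hA hxy hd hdet hone hγ
  exact le_antisymm (csInf_le ⟨1, hle⟩ hmem) (le_csInf ⟨1, hmem⟩ hle)

lemma liminf_nonneg {u : ℕ → ℝ} (h : ∀ n, 0 ≤ u n) : 0 ≤ liminf u atTop := by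
  rw [liminf_eq]
  exact Real.sSup_nonneg' ⟨0, Eventually.of_forall h, le_rfl⟩

lemma condRho_le {x y : ℕ → A} {m d : ℕ} (hd : 2 ≤ d)
    {C : Comp3 A A (Fin d) (Fin m)} (hdet : C.TwoDet) (hone : C.OneToOne)
    {γ : ℕ → Fin m × (Option A × Option A) × List (Fin d) × Fin m} (hγ : C.IsAccRunOn γ x y) :
    condRho x y ≤ liminf (fun n : ℕ => (((c3out γ n).length : ℝ) * Real.log d) /
      (((c3in1 γ n).length : ℝ) * Real.log (Fintype.card A))) atTop := by
  refine csInf_le ⟨0, ?_⟩ ⟨m, d, hd, C, hdet, hone, γ, hγ, rfl⟩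
  rintro _ ⟨m, d, hd, C, hdet, hone, γ, hγ, rfl⟩
  exact liminf_nonneg fun n => by positivity

end Values

section Machine
variable {K : Type*} [Finite K] {d : ℕ}

/-- The `3`-automaton that reads one symbol from the tape prescribed by its state. -/
noncomputable def machine (k₀ : K) (ty : K → Bool) (nxt : K → A → K) (out : K → A → List (Fin d)) :
    Comp3 A A (Fin d) (Fin (Nat.card K)) where
  init := Finite.equivFin K k₀
  trans := {t | ∃ k a, t = (Finite.equivFin K k,
    (if ty k then (some a, none) else (none, some a)), out k a, Finite.equivFin K (nxt k a))}

variable {k₀ : K} {ty : K → Bool} {nxt : K → A → K} {out : K → A → List (Fin d)}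

lemma machine_twoDet : (machine k₀ ty nxt out).TwoDet := by
  rintro _ ⟨k, a, rfl⟩ _ ⟨k', a', rfl⟩ h
  obtain rfl := (Finite.equivFin K).injective h
  cases ty k <;> simp only [lsupp, if_true, Bool.false_eq_true, if_false,
    Option.isSome_some, Option.isSome_none, true_and, Prod.mk.injEq, Option.some.injEq, and_true]
    <;> (rintro rfl; simp)

/-- The run of `machine` with states `s` on which the symbols `z` are read. -/
noncomputable def machineRun (ty : K → Bool) (nxt : K → A → K) (out : K → A → List (Fin d))
    (z : ℕ → A) (s : ℕ → K) (n : ℕ) :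
    Fin (Nat.card K) × (Option A × Option A) × List (Fin d) × Fin (Nat.card K) :=
  (Finite.equivFin K (s n), (if ty (s n) then (some (z n), none) else (none, some (z n))),
    out (s n) (z n), Finite.equivFin K (nxt (s n) (z n)))

lemma machineRun_in1 (z : ℕ → A) (s : ℕ → K) (n : ℕ) :
    c3in1 (machineRun ty nxt out z s) n = seg (readAt z s ty true) 0 n := by
  rw [c3in1_eq]
  congr 1
  funext i
  cases h : ty (s i) <;> simp [machineRun, readAt, h]

lemma machineRun_in2 (z : ℕ → A) (s : ℕ → K) (n : ℕ) :
    c3in2 (machineRun ty nxt out z s) n = seg (readAt z s ty false) 0 n := by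
  rw [c3in2_eq]
  congr 1
  funext i
  cases h : ty (s i) <;> simp [machineRun, readAt, h]

lemma machineRun_out (z : ℕ → A) (s : ℕ → K) (n : ℕ) :
    c3out (machineRun ty nxt out z s) n = seg (fun i => out (s i) (z i)) 0 n := by
  rw [c3out_eq]; rfl

lemma machineRun_isAccRunOn {z : ℕ → A} {s : ℕ → K} {x y : ℕ → A} (h0 : s 0 = k₀)
    (hs : ∀ n, s (n + 1) = nxt (s n) (z n))
    (hx : ∀ t, seg (readAt z s ty true) 0 t = pref x (seg (readAt z s ty true) 0 t).length)
    (hy : ∀ t, seg (readAt z s ty false) 0 t = pref y (seg (readAt z s ty false) 0 t).length)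
    (hxt : Tendsto (fun t => (seg (readAt z s ty true) 0 t).length) atTop atTop)
    (hyt : Tendsto (fun t => (seg (readAt z s ty false) 0 t).length) atTop atTop)
    (hot : Tendsto (fun t => (seg (fun i => out (s i) (z i)) 0 t).length) atTop atTop) :
    (machine k₀ ty nxt out).IsAccRunOn (machineRun ty nxt out z s) x y := by
  refine ⟨by simp [machineRun, machine, h0], fun n => ⟨s n, z n, rfl⟩,
    fun n => by simp [machineRun, hs], ?_, ?_, ?_, ?_, ?_⟩
  · simpa only [machineRun_in1] using hx
  · simpa only [machineRun_in2] using hy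
  · simpa only [machineRun_in1] using hxt
  · simpa only [machineRun_in2] using hyt
  · simpa only [machineRun_out] using hot

lemma exists_eq_machineRun {x y : ℕ → A} {γ}
    (hγ : (machine k₀ ty nxt out).IsAccRunOn γ x y) :
    ∃ (z : ℕ → A) (s : ℕ → K), s 0 = k₀ ∧ (∀ n, s (n + 1) = nxt (s n) (z n)) ∧
      γ = machineRun ty nxt out z s := by
  choose s z hz using hγ.2.1
  refine ⟨z, s, ?_, fun n => ?_, funext hz⟩
  · have := hγ.1
    rw [hz 0] at this
    exact (Finite.equivFin K).injective this
  · have := hγ.2.2.1 n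
    rw [hz n, hz (n + 1)] at this
    exact (Finite.equivFin K).injective this.symm

/-- A machine is one-to-one if reading distinct symbols of the first tape from the same state
eventually leads to distinct output letters. -/
lemma machine_oneToOne (R : K → A → Fin d → Prop)
    (hR : ∀ k a a' v, ty k = true → R k a v → R k a' v → a = a')
    (hemit : ∀ (z : ℕ → A) (s : ℕ → K), s 0 = k₀ → (∀ n, s (n + 1) = nxt (s n) (z n)) →
      Tendsto (fun t => (seg (fun i => out (s i) (z i)) 0 t).length) atTop atTop →
      ∀ n, ty (s n) = true → ∃ v, R (s n) (z n) v ∧ ∃ j,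
        seg (fun i => out (s i) (z i)) 0 n ++ [v] <+: seg (fun i => out (s i) (z i)) 0 j) :
    (machine k₀ ty nxt out).OneToOne := by
  intro x x' y γ γ' hγ hγ' h1 h2
  obtain ⟨z, s, h0, hs, rfl⟩ := exists_eq_machineRun hγ
  obtain ⟨z', s', h0', hs', rfl⟩ := exists_eq_machineRun hγ'
  obtain ⟨-, -, -, gi, gj, gti, -, gto⟩ := hγ
  obtain ⟨-, -, -, gi', gj', -, -, gto'⟩ := hγ'
  simp only [machineRun_in1, machineRun_in2, machineRun_out] at gi gj gti gto gi' gj' gto' h1 h2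
  have key : ∀ n, s n = s' n ∧ ∀ i < n, s i = s' i ∧ z i = z' i := by
    intro n
    induction n with
    | zero => exact ⟨h0.trans h0'.symm, fun i hi => absurd hi (Nat.not_lt_zero _)⟩
    | succ n ih =>
      obtain ⟨hsn, hlt⟩ := ih
      have hzn : z n = z' n := by
        cases hty : ty (s n) with
        | false =>
          rw [← readAt_symbol gj hty, ← readAt_symbol gj' (hsn ▸ hty)]
          congr 2
          simpa using seg_congr (a := 0) (a' := 0) n fun i hi => by
            simp [readAt, (hlt i hi).1, (hlt i hi).2]
        | true =>
          obtain ⟨v, hv, j, hj⟩ := hemit z s h0 hs gto n hty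
          obtain ⟨v', hv', j', hj'⟩ := hemit z' s' h0' hs' gto' n (hsn ▸ hty)
          have heq : seg (fun i => out (s i) (z i)) 0 n = seg (fun i => out (s' i) (z' i)) 0 n := by
            simpa using seg_congr (f := fun i => out (s i) (z i))
              (f' := fun i => out (s' i) (z' i)) (a := 0) (a' := 0) n fun i hi => by
              simp [(hlt i hi).1, (hlt i hi).2]
          obtain ⟨m, hm⟩ := h1 j
          have e1 := (hj.trans hm).trans (seg_zero_prefix _ (le_max_left m j'))
          have e2 := hj'.trans (seg_zero_prefix (fun i => out (s' i) (z' i)) (le_max_right m j'))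
          have e3 := (List.prefix_of_prefix_length_le e1 e2 (by simp [heq])).eq_of_length
            (by simp [heq])
          rw [heq] at e3
          have e4 : v = v' := by simpa using List.append_cancel_left e3
          rw [← hsn, ← e4] at hv'
          exact hR _ _ _ _ hty hv hv'
      refine ⟨by rw [hs, hs', hsn, hzn], fun i hi => ?_⟩
      rcases (Nat.lt_succ_iff.1 hi).lt_or_eq with h | rfl
      · exact hlt i h
      · exact ⟨hsn, hzn⟩
  refine eq_of_pref_eq fun n => ?_
  obtain ⟨t, ht⟩ := (tendsto_atTop.1 gti n).exists
  refine ⟨_, ht, ?_⟩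
  have e : seg (readAt z s ty true) 0 t = seg (readAt z' s' ty true) 0 t := by
    simpa using seg_congr (f := readAt z s ty true) (f' := readAt z' s' ty true) (a := 0)
      (a' := 0) t fun i _ => by simp [readAt, (key i).1, ((key (i + 1)).2 i (Nat.lt_succ_self i)).2]
  rw [← gi, e, ← gi']

end Machine

/-! ### Arithmetic coding -/

section Coding
variable {F : Type*} (p : F → A → ℝ)

/-- The probability of a history, most recent symbol first. -/
def prob : List (F × A) → ℝ
  | [] => 1
  | c :: h => p c.1 c.2 * prob h

variable [Fintype A]

/-- The mass of the symbols that precede `a`. -/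
noncomputable def cum (σ : F) (a : A) : ℝ :=
  ∑ c with Fintype.equivFin A c < Fintype.equivFin A a, p σ c

/-- The left end of the interval assigned to a history. -/
noncomputable def lo : List (F × A) → ℝ
  | [] => 0
  | c :: h => lo h + prob p h * cum p c.1 c.2

variable {p}

omit [Fintype A] in
lemma prob_pos (hp : ∀ σ a, 0 < p σ a) : ∀ h, 0 < prob p h
  | [] => one_pos
  | _ :: h => mul_pos (hp _ _) (prob_pos hp h)

lemma cum_nonneg (hp : ∀ σ a, 0 < p σ a) (σ : F) (a : A) : 0 ≤ cum p σ a :=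
  Finset.sum_nonneg fun c _ => (hp σ c).le

lemma cum_add_le_cum (hp : ∀ σ a, 0 < p σ a) {σ : F} {a a' : A}
    (h : Fintype.equivFin A a < Fintype.equivFin A a') : cum p σ a + p σ a ≤ cum p σ a' := by
  classical
  unfold cum
  rw [add_comm, ← Finset.sum_insert (s := Finset.univ.filter _) (a := a) (by simp)]
  refine Finset.sum_le_sum_of_subset_of_nonneg ?_ fun c _ _ => (hp σ c).le
  intro c hc
  simp only [Finset.mem_insert, Finset.mem_filter, Finset.mem_univ, true_and] at hc ⊢
  rcases hc with rfl | hc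
  exacts [h, hc.trans h]

lemma cum_add_le_one (hp : ∀ σ a, 0 < p σ a) (hp1 : ∀ σ, ∑ a, p σ a = 1) (σ : F) (a : A) :
    cum p σ a + p σ a ≤ 1 := by
  classical
  unfold cum
  rw [← hp1 σ, add_comm, ← Finset.sum_insert (s := Finset.univ.filter _) (a := a) (by simp)]
  exact Finset.sum_le_sum_of_subset_of_nonneg (Finset.subset_univ _) fun c _ _ => (hp σ c).le

lemma lo_suffix (hp : ∀ σ a, 0 < p σ a) (hp1 : ∀ σ, ∑ a, p σ a = 1) {h E : List (F × A)}
    (hE : h <:+ E) : lo p h ≤ lo p E ∧ lo p E + prob p E ≤ lo p h + prob p h := by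
  obtain ⟨l, rfl⟩ := hE
  induction l with
  | nil => simp
  | cons c l ih =>
    have h1 := prob_pos hp (l ++ h)
    have h2 := mul_nonneg h1.le (cum_nonneg hp c.1 c.2)
    have h3 := mul_le_mul_of_nonneg_left (cum_add_le_one hp hp1 c.1 c.2) h1.le
    simp only [List.cons_append, lo, prob]
    constructor
    · linarith [ih.1]
    · nlinarith [ih.2]

lemma lo_add_prob_le_one (hp : ∀ σ a, 0 < p σ a) (hp1 : ∀ σ, ∑ a, p σ a = 1)
    (E : List (F × A)) : 0 ≤ lo p E ∧ lo p E + prob p E ≤ 1 := by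
  simpa [lo, prob] using lo_suffix hp hp1 (List.nil_suffix (l := E))

variable (p) in
/-- The output letter encoding a history. -/
noncomputable def letter {d : ℕ} (hd : 0 < d) (E : List (F × A)) : Fin d :=
  ⟨⌊lo p E * d⌋₊ % d, Nat.mod_lt _ hd⟩

lemma floor_lt_floor {d : ℕ} (hd : 0 < d) {u v w : ℝ} (hu : 0 ≤ u) (hw : 1 / (d : ℝ) ≤ w)
    (h : u + w ≤ v) : ⌊u * d⌋₊ < ⌊v * d⌋₊ := by
  have hd' : (0 : ℝ) < d := by exact_mod_cast hd
  have h1 : 1 ≤ w * d := by rwa [div_le_iff₀ hd'] at hw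
  rw [← Nat.succ_le_iff, Nat.succ_eq_add_one, ← Nat.floor_add_one (by positivity)]
  refine Nat.floor_le_floor ?_
  nlinarith

lemma letter_inj (hp : ∀ σ a, 0 < p σ a) (hp1 : ∀ σ, ∑ a, p σ a = 1) {d : ℕ} (hd : 0 < d)
    {σ : F} {a a' : A} {h E E' : List (F × A)} (hE : (σ, a) :: h <:+ E)
    (hE' : (σ, a') :: h <:+ E') (hP : 1 / (d : ℝ) ≤ prob p E) (hP' : 1 / (d : ℝ) ≤ prob p E')
    (hl : letter p hd E = letter p hd E') : a = a' := by
  have hd' : (0 : ℝ) < d := by exact_mod_cast hd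
  have hmod : ∀ {E : List (F × A)}, ⌊lo p E * d⌋₊ % d = ⌊lo p E * d⌋₊ := by
    intro E
    refine Nat.mod_eq_of_lt ?_
    have h1 := lo_add_prob_le_one hp hp1 E
    have h2 := prob_pos hp E
    rw [Nat.floor_lt (mul_nonneg h1.1 hd'.le)]
    nlinarith
  have hl' : ⌊lo p E * d⌋₊ = ⌊lo p E' * d⌋₊ := by
    have := congrArg Fin.val hl
    simpa only [letter, hmod] using this
  have key : ∀ {a a' : A} {E E' : List (F × A)}, (σ, a) :: h <:+ E → (σ, a') :: h <:+ E' →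
      1 / (d : ℝ) ≤ prob p E → Fintype.equivFin A a < Fintype.equivFin A a' →
      ⌊lo p E * d⌋₊ < ⌊lo p E' * d⌋₊ := by
    intro a a' E E' hE hE' hP hlt
    refine floor_lt_floor hd (lo_add_prob_le_one hp hp1 E).1 hP ?_
    have h1 := (lo_suffix hp hp1 hE).2
    have h2 := (lo_suffix hp hp1 hE').1
    have h3 := mul_le_mul_of_nonneg_left (cum_add_le_cum hp (σ := σ) hlt) (prob_pos hp h).le
    simp only [lo, prob] at h1 h2
    nlinarith
  rcases lt_trichotomy (Fintype.equivFin A a) (Fintype.equivFin A a') with h1 | h1 | h1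
  · exact absurd hl' (key hE hE' hP h1).ne
  · exact (Fintype.equivFin A).injective h1
  · exact absurd hl' (key hE' hE hP' h1).ne'

end Coding

section Encoder
variable {F : Type*} [Finite F] [Finite A] {p : F → A → ℝ}
  {θ : ℝ} {T : ℕ}

variable (p T) in
/-- The histories that have not been encoded yet. -/
abbrev Hist := {h : List (F × A) // 1 / (T : ℝ) < prob p h}

omit [Finite F] [Finite A] in
lemma prob_le_pow (hp : ∀ σ a, 0 < p σ a) (hθ : ∀ σ a, p σ a ≤ θ) (hθ0 : 0 ≤ θ) :
    ∀ h : List (F × A), prob p h ≤ θ ^ h.length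
  | [] => by simp [prob]
  | c :: h => by
    rw [prob, List.length_cons, pow_succ']
    exact mul_le_mul (hθ _ _) (prob_le_pow hp hθ hθ0 h) (prob_pos hp h).le hθ0

omit [Finite F] [Finite A] in
lemma exists_hist_length (hp : ∀ σ a, 0 < p σ a) (hθ : ∀ σ a, p σ a ≤ θ) (hθ0 : 0 ≤ θ)
    (hθ1 : θ < 1) (hT : 0 < T) : ∃ L, ∀ h : Hist p T, h.1.length ≤ L := by
  have hT' : (0 : ℝ) < 1 / T := by positivity
  obtain ⟨L, hL⟩ := exists_pow_lt_of_lt_one hT' hθ1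
  refine ⟨L, fun h => ?_⟩
  by_contra! hlt
  have h1 := prob_le_pow hp hθ hθ0 h.1
  have h2 := pow_le_pow_of_le_one hθ0 hθ1.le hlt.le
  linarith [h.2]

lemma finite_hist {L : ℕ} (hL : ∀ h : Hist p T, h.1.length ≤ L) : Finite (Hist p T) :=
  ((List.finite_length_le (F × A) L).subset fun h hh => hL ⟨h, hh⟩).to_subtype

end Encoder

section Encoder
variable {K : Type*} {F : Type*} [Fintype A] {p : F → A → ℝ} {θ : ℝ} {T d : ℕ}
  {ty : K → Bool} {flag : K → F} {δ : K → A → K}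

open Classical in
/-- The history after a further symbol, reset when it becomes unlikely. -/
noncomputable def push (hT : 2 ≤ T) (h : Hist p T) (c : F × A) : Hist p T :=
  if hc : 1 / (T : ℝ) < prob p (c :: h.1) then ⟨c :: h.1, hc⟩
  else ⟨[], by
    rw [prob, one_div]
    exact inv_lt_one_of_one_lt₀ (by exact_mod_cast (show 1 < T by omega))⟩

open Classical in
/-- The output produced when a history is reset. -/
noncomputable def emit (hd : 0 < d) (h : Hist p T) (c : F × A) : List (Fin d) :=
  if 1 / (T : ℝ) < prob p (c :: h.1) then [] else [letter p hd (c :: h.1)]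

variable (ty flag δ) in
/-- The transition function of the arithmetic encoder. -/
noncomputable def encNext (hT : 2 ≤ T) (k : K × Hist p T) (a : A) : K × Hist p T :=
  (δ k.1 a, if ty k.1 then push hT k.2 (flag k.1, a) else k.2)

variable (ty flag) in
/-- The output function of the arithmetic encoder. -/
noncomputable def encOut (hd : 0 < d) (k : K × Hist p T) (a : A) : List (Fin d) :=
  if ty k.1 then emit hd k.2 (flag k.1, a) else []

lemma push_emit (hT : 2 ≤ T) (hd : 0 < d) (h : Hist p T) (c : F × A) :
    ((push hT h c).1 = c :: h.1 ∧ emit hd h c = []) ∨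
      ((push hT h c).1 = [] ∧ emit hd h c = [letter p hd (c :: h.1)] ∧
        prob p (c :: h.1) ≤ 1 / T) := by
  by_cases hc : 1 / (T : ℝ) < prob p (c :: h.1)
  · left; simp only [push, emit, hc, dite_true, if_true, and_self]
  · right; simp only [push, emit, hc, dite_false, if_false, true_and]; exact not_lt.1 hc

omit [Fintype A] in
/-- A lower bound on the symbol probabilities carries over to encoded histories. -/
lemma one_div_le_prob_cons {κ : ℝ} (hκ : 0 < κ) (hlow : ∀ σ a, 1 / κ ≤ p σ a) (hT : 2 ≤ T)
    (hd : (d : ℝ) = κ * T) (h : Hist p T) (c : F × A) : 1 / (d : ℝ) ≤ prob p (c :: h.1) := by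
  have : (0 : ℝ) < T := by positivity
  rw [hd, one_div_mul_one_div_rev _ _ |>.symm, mul_comm]
  exact mul_le_mul (hlow _ _) h.2.le (by positivity) ((by positivity : 0 ≤ 1 / κ).trans (hlow c.1 c.2))

lemma enc_oneToOne [Finite K] [Finite (Hist p T)] (hp : ∀ σ a, 0 < p σ a)
    (hp1 : ∀ σ, ∑ a, p σ a = 1) (hT : 2 ≤ T) (hd : 0 < d)
    (hlow : ∀ (h : Hist p T) c, 1 / (d : ℝ) ≤ prob p (c :: h.1)) (k₀ : K × Hist p T) :
    (machine k₀ (fun k => ty k.1) (encNext ty flag δ hT) (encOut ty flag hd)).OneToOne := by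
  refine machine_oneToOne (fun k a v => ∃ E, (flag k.1, a) :: k.2.1 <:+ E ∧
    1 / (d : ℝ) ≤ prob p E ∧ letter p hd E = v) ?_ ?_
  · rintro k a a' v - ⟨E, h1, h2, h3⟩ ⟨E', h1', h2', h3'⟩
    exact letter_inj hp hp1 hd h1 h1' h2 h2' (h3.trans h3'.symm)
  intro z s h0 hs ht n hn
  set o := fun i => encOut ty flag hd (s i) (z i) with ho
  have key : ∀ j, n + 1 ≤ j →
      (seg o 0 j = seg o 0 n ∧ (flag (s n).1, z n) :: (s n).2.1 <:+ (s j).2.1) ∨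
      ∃ v, (∃ E, (flag (s n).1, z n) :: (s n).2.1 <:+ E ∧
        1 / (d : ℝ) ≤ prob p E ∧ letter p hd E = v) ∧ seg o 0 n ++ [v] <+: seg o 0 j := by
    intro j hj
    induction j, hj using Nat.le_induction with
    | base =>
      rw [seg_succ _ (Nat.zero_le _), hs]
      simp only [ho, encOut, encNext, hn, if_true]
      rcases push_emit hT hd (s n).2 (flag (s n).1, z n) with ⟨h1, h2⟩ | ⟨h1, h2, h3⟩
      · left; rw [h1, h2]; simp
      · right; rw [h2]; exact ⟨_, ⟨_, List.suffix_rfl, hlow _ _, rfl⟩, List.prefix_rfl⟩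
    | succ j hj ih =>
      rw [seg_succ _ (Nat.zero_le j), hs]
      rcases ih with ⟨h1, h2⟩ | ⟨v, hv, h2⟩
      · rw [h1]
        cases hty : ty (s j).1 with
        | false => left; simp [ho, encOut, encNext, hty, h2]
        | true =>
          simp only [ho, encOut, encNext, hty, if_true]
          rcases push_emit hT hd (s j).2 (flag (s j).1, z j) with ⟨g1, g2⟩ | ⟨g1, g2, g3⟩
          · left; rw [g1, g2]; exact ⟨by simp, h2.trans (List.suffix_cons _ _)⟩
          · right; rw [g2]
            exact ⟨_, ⟨_, h2.trans (List.suffix_cons _ _), hlow _ _, rfl⟩, List.prefix_rfl⟩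
      · exact Or.inr ⟨v, hv, h2.trans (List.prefix_append _ _)⟩
  obtain ⟨j, hj1, hj2⟩ := ((tendsto_atTop.1 ht ((seg o 0 n).length + 1)).and
    (eventually_ge_atTop (n + 1))).exists
  rcases key j hj2 with ⟨h1, -⟩ | ⟨v, hv, h2⟩
  · rw [h1] at hj1; omega
  · exact ⟨v, hv, j, h2⟩

/-- Arithmetic coding of the symbols read from the first tape, with respect to probabilities that
depend on the state of a finite-state machine. -/
theorem exists_coding (hA : 2 ≤ Fintype.card A) [Finite K] [Finite F] {x y z : ℕ → A} {s : ℕ → K}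
    (hs : ∀ n, s (n + 1) = δ (s n) (z n))
    (hx : ∀ t, seg (readAt z s ty true) 0 t = pref x (seg (readAt z s ty true) 0 t).length)
    (hy : ∀ t, seg (readAt z s ty false) 0 t = pref y (seg (readAt z s ty false) 0 t).length)
    (hxt : Tendsto (fun t => (seg (readAt z s ty true) 0 t).length) atTop atTop)
    (hyt : Tendsto (fun t => (seg (readAt z s ty false) 0 t).length) atTop atTop)
    {κ : ℕ} (hκ : 0 < κ) (hlow : ∀ σ a, 1 / (κ : ℝ) ≤ p σ a) (hθ : ∀ σ a, p σ a ≤ θ) (hθ1 : θ < 1)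
    (hp1 : ∀ σ, ∑ a, p σ a = 1) (hT : 2 ≤ T) :
    ∃ M : ℕ → ℕ,
      (∀ n, M n * Real.log T ≤
        -∑ i ∈ Finset.range n, if ty (s i) then Real.log (p (flag (s i)) (z i)) else 0) ∧
      condRho x y ≤ liminf (fun n => (M n * Real.log (κ * T)) /
        ((seg (readAt z s ty true) 0 n).length * Real.log (Fintype.card A))) atTop := by
  have hκ' : (0 : ℝ) < κ := by exact_mod_cast hκ
  have hT' : (0 : ℝ) < T := by positivity
  have hp : ∀ σ a, 0 < p σ a := fun σ a => (by positivity : 0 < 1 / (κ : ℝ)).trans_le (hlow σ a)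
  have hθ0 : 0 ≤ θ := by
    have : Nonempty A := Fintype.card_pos_iff.1 (by omega)
    exact (hp (flag (s 0)) (Classical.arbitrary A)).le.trans (hθ _ _)
  obtain ⟨L, hL⟩ := exists_hist_length hp hθ hθ0 hθ1 (show 0 < T by omega)
  have : Finite (Hist p T) := finite_hist hL
  have hd : 0 < κ * T := by positivity
  have hlow' : ∀ (h : Hist p T) c, 1 / ((κ * T : ℕ) : ℝ) ≤ prob p (c :: h.1) :=
    one_div_le_prob_cons hκ' hlow hT (by push_cast; rfl)
  let e : Hist p T := ⟨[], by
    rw [prob, one_div]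
    exact inv_lt_one_of_one_lt₀ (by exact_mod_cast (show 1 < T by omega))⟩
  let r : ℕ → K × Hist p T := fun n =>
    Nat.rec (s 0, e) (fun n k => encNext ty flag δ hT k (z n)) n
  have hr : ∀ n, r (n + 1) = encNext ty flag δ hT (r n) (z n) := fun _ => rfl
  have hr1 : ∀ n, (r n).1 = s n := by
    intro n
    induction n with
    | zero => rfl
    | succ n ih => rw [hr, hs, ← ih]; rfl
  have hread : ∀ b, readAt z r (fun k => ty k.1) b = readAt z s ty b := fun b => by
    funext i; simp [readAt, hr1]
  set o := fun i => encOut ty flag hd (r i) (z i)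
  have ho : ∀ i, o i = encOut ty flag hd (r i) (z i) := fun _ => rfl
  have inv1 : ∀ n, ((seg o 0 n).length : ℝ) * Real.log T ≤
      (-∑ i ∈ Finset.range n, if ty (s i) then Real.log (p (flag (s i)) (z i)) else 0) +
        Real.log (prob p (r n).2.1) := by
    intro n
    induction n with
    | zero => simp [r, e, prob]
    | succ n ih =>
      rw [seg_succ _ (Nat.zero_le _), Finset.sum_range_succ, hr]
      cases hty : ty (s n) with
      | false => simpa [ho, encOut, encNext, hr1, hty] using ih
      | true =>
        simp only [ho, encOut, encNext, hr1, hty, if_true]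
        have h1 : Real.log (prob p ((flag (s n), z n) :: (r n).2.1)) =
            Real.log (p (flag (s n)) (z n)) + Real.log (prob p (r n).2.1) :=
          Real.log_mul (hp _ _).ne' (prob_pos hp _).ne'
        rcases push_emit hT hd (r n).2 (flag (s n), z n) with ⟨g1, g2⟩ | ⟨g1, g2, g3⟩
        · rw [g1, g2, h1]
          simp only [List.append_nil]
          linarith
        · rw [g1, g2]
          have h2 := Real.log_le_log (prob_pos hp _) g3
          have h3 : Real.log (1 / (T : ℝ)) = -Real.log T := by rw [one_div, Real.log_inv]
          rw [h1] at h2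
          simp only [List.length_append, List.length_singleton, prob, Real.log_one]
          push_cast
          linarith
  have inv2 : ∀ n, (seg (readAt z s ty true) 0 n).length ≤
      (seg o 0 n).length * (L + 1) + (r n).2.1.length := by
    intro n
    induction n with
    | zero => simp
    | succ n ih =>
      rw [seg_succ _ (Nat.zero_le _), seg_succ _ (Nat.zero_le _), hr]
      cases hty : ty (s n) with
      | false => simpa [ho, encOut, encNext, hr1, hty, readAt] using ih
      | true =>
        simp only [ho, encOut, encNext, hr1, hty, if_true, readAt]
        rcases push_emit hT hd (r n).2 (flag (s n), z n) with ⟨g1, g2⟩ | ⟨g1, g2, g3⟩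
        · rw [g1, g2]
          simp only [List.append_nil, List.length_append, List.length_cons, List.length_nil]
          omega
        · rw [g1, g2]
          have := hL (r n).2
          simp only [List.length_append, List.length_cons, List.length_nil]
          rw [Nat.zero_add, Nat.add_mul]
          omega
  have hot : Tendsto (fun t => (seg o 0 t).length) atTop atTop := by
    refine tendsto_atTop.2 fun b => ?_
    filter_upwards [tendsto_atTop.1 hxt (b * (L + 1) + L)] with n hn
    by_contra! hlt
    have h1 := inv2 n
    have h2 := hL (r n).2
    have h3 : (seg o 0 n).length * (L + 1) + (L + 1) ≤ b * (L + 1) := by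
      rw [← Nat.succ_mul]; exact Nat.mul_le_mul_right _ hlt
    omega
  refine ⟨fun n => (seg o 0 n).length, fun n => (inv1 n).trans ?_, ?_⟩
  · have h1 : Real.log (prob p (r n).2.1) ≤ 0 := by
      refine Real.log_nonpos (prob_pos hp _).le ?_
      exact (prob_le_pow hp hθ hθ0 _).trans (pow_le_one₀ hθ0 hθ1.le)
    linarith
  · have hrun := machineRun_isAccRunOn (k₀ := r 0) (ty := fun k : K × Hist p T => ty k.1)
      (nxt := encNext ty flag δ hT) (out := encOut ty flag hd) (z := z) (s := r) (x := x) (y := y)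
      rfl hr (by simpa only [hread] using hx) (by simpa only [hread] using hy)
      (by simpa only [hread] using hxt) (by simpa only [hread] using hyt) hot
    have h2 : 2 ≤ κ * T := hT.trans (Nat.le_mul_of_pos_left _ hκ)
    have := condRho_le h2 machine_twoDet (enc_oneToOne hp hp1 hT hd hlow' (r 0)) hrun
    simpa only [machineRun_in1, machineRun_out, hread, Nat.cast_mul] using this

end Encoder

/-! ### A biased statistic yields compression -/

section Gain
variable {K : Type*}

lemma length_readAt_eq_sum (z : ℕ → A) (s : ℕ → K) (ty : K → Bool) (b : Bool) (n : ℕ) :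
    ((seg (readAt z s ty b) 0 n).length : ℝ) =
      ∑ i ∈ Finset.range n, if ty (s i) = b then 1 else 0 := by
  induction n with
  | zero => simp
  | succ n ih =>
    rw [seg_succ _ (Nat.zero_le _), Finset.sum_range_succ, ← ih, readAt]
    split_ifs <;> simp

lemma sub_two_mul_sq_le_log {t : ℝ} (ht : |t| ≤ 1 / 2) : t - 2 * t ^ 2 ≤ Real.log (1 + t) := by
  obtain ⟨h1, h2⟩ := abs_le.1 ht
  have h3 : (0 : ℝ) < 1 + t := by linarith
  refine le_trans ?_ (Real.one_sub_inv_le_log_of_pos h3)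
  rw [le_sub_iff_add_le, ← le_sub_iff_add_le', inv_le_iff_one_le_mul₀ h3]
  nlinarith [mul_nonneg (sq_nonneg t) (by linarith : 0 ≤ 1 + 2 * t)]

variable [Fintype A] {ty : K → Bool} {δ : K → A → K}

/-- A symbol of the first tape whose frequency at selected times is biased can be exploited by
a conditional compressor. -/
theorem condRho_lt_one [DecidableEq A] (hA : 2 ≤ Fintype.card A) [Finite K] {x y z : ℕ → A}
    {s : ℕ → K} (hs : ∀ n, s (n + 1) = δ (s n) (z n))
    (hx : ∀ t, seg (readAt z s ty true) 0 t = pref x (seg (readAt z s ty true) 0 t).length)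
    (hy : ∀ t, seg (readAt z s ty false) 0 t = pref y (seg (readAt z s ty false) 0 t).length)
    (hxt : Tendsto (fun t => (seg (readAt z s ty true) 0 t).length) atTop atTop)
    (hyt : Tendsto (fun t => (seg (readAt z s ty false) 0 t).length) atTop atTop)
    (flag : K → Bool) (hflag : ∀ q, flag q = true → ty q = true) (b : A) {c : ℝ} (hc : 0 < c)
    (hfreq : ∃ᶠ n : ℕ in atTop, c * n ≤ |∑ i ∈ Finset.range n,
      if flag (s i) then (if z i = b then 1 else 0) - 1 / (Fintype.card A : ℝ) else 0|) :
    condRho x y < 1 := by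
  set k := Fintype.card A with hk
  have hk2 : (2 : ℝ) ≤ k := by exact_mod_cast hA
  have hlk : 0 < Real.log k := Real.log_pos (by linarith)
  set dev : ℕ → ℝ := fun n => ∑ i ∈ Finset.range n,
      if flag (s i) then (if z i = b then 1 else 0) - 1 / (k : ℝ) else 0 with hdev
  obtain ⟨σ, hσ, hfreq⟩ : ∃ σ : ℝ, |σ| = 1 ∧ ∃ᶠ n : ℕ in atTop, c * n ≤ σ * dev n := by
    have : ∃ᶠ n : ℕ in atTop, c * n ≤ dev n ∨ c * n ≤ -dev n :=
      hfreq.mono fun n hn => le_abs.1 hn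
    rcases frequently_or_distrib.1 this with h | h
    · exact ⟨1, by simp, by simpa using h⟩
    · exact ⟨-1, by simp, by simpa using h⟩
  set e := min c 1 with he
  have he0 : 0 < e := lt_min hc one_pos
  have he1 : e ≤ 1 := min_le_right _ _
  set t : A → ℝ := fun a => σ * e / 4 * ((if a = b then 1 else 0) - 1 / (k : ℝ)) with ht
  have ht1 : ∀ a, |t a| ≤ e / 4 := by
    intro a
    have h1 : |(if a = b then 1 else 0) - 1 / (k : ℝ)| ≤ 1 := by
      have : 0 ≤ 1 / (k : ℝ) := by positivity
      have : 1 / (k : ℝ) ≤ 1 := by rw [div_le_one (by linarith)]; linarith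
      rw [abs_le]
      split_ifs <;> constructor <;> linarith
    rw [ht]
    simp only [abs_mul, abs_div, hσ, abs_of_pos he0, one_mul]
    rw [abs_of_pos (by norm_num : (0 : ℝ) < 4)]
    exact mul_le_of_le_one_right (by positivity) h1
  have ht2 : ∀ a, |t a| ≤ 1 / 2 := fun a => (ht1 a).trans (by linarith)
  have htsum : ∑ a, t a = 0 := by
    simp only [ht]
    rw [← Finset.mul_sum, Finset.sum_sub_distrib]
    simp [← hk]
    right
    field_simp
    simp
  set p : Bool → A → ℝ := fun f a => (1 + if f then t a else 0) / k with hp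
  have hft : ∀ (f : Bool) a, |if f then t a else 0| ≤ 1 / 2 := by
    intro f a
    cases f
    · simp
    · simpa using ht2 a
  have hp1 : ∀ f, ∑ a, p f a = 1 := by
    intro f
    rw [← Finset.sum_div, Finset.sum_add_distrib]
    have hk0 : (k : ℝ) ≠ 0 := by linarith
    cases f <;> simp [← hk, htsum, hk0]
  set g := e ^ 2 / 8 / Real.log k with hg
  have hg0 : 0 < g := by positivity
  obtain ⟨T, hT⟩ := exists_nat_ge (max 2 (Real.exp (Real.log (2 * k) / g)))
  have hT2 : (2 : ℝ) ≤ T := (le_max_left _ _).trans hT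
  have hT3 : Real.log (2 * k) / g ≤ Real.log T := by
    rw [Real.le_log_iff_exp_le (by linarith)]
    exact (le_max_right _ _).trans hT
  have hlT : 0 < Real.log T := Real.log_pos (by linarith)
  obtain ⟨M, hM, hle⟩ := exists_coding (p := p) (flag := flag) (κ := 2 * k) (θ := 3 / 4) (T := T)
    hA hs hx hy hxt hyt (by positivity)
    (fun f a => by
      have := (abs_le.1 (hft f a)).1
      simp only [hp]
      push_cast
      rw [div_le_div_iff₀ (by linarith) (by linarith)]
      nlinarith)
    (fun f a => by
      have := (abs_le.1 (hft f a)).2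
      simp only [hp]
      rw [div_le_iff₀ (by linarith)]
      nlinarith)
    (by norm_num) hp1 (by exact_mod_cast hT2)
  rw [← hk] at hle
  set X : ℕ → ℝ := fun n => ((seg (readAt z s ty true) 0 n).length : ℝ) with hX
  have hM2 : ∀ n, c * n ≤ σ * dev n → M n * Real.log T ≤ X n * Real.log k * (1 - g) := by
    intro n hn
    have h1 : X n * -Real.log k + e / 4 * (σ * dev n) - e ^ 2 / 8 * n ≤
        ∑ i ∈ Finset.range n, if ty (s i) then Real.log (p (flag (s i)) (z i)) else 0 := by
      rw [hX]
      simp only [length_readAt_eq_sum, hdev]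
      rw [Finset.sum_mul, Finset.mul_sum, Finset.mul_sum, ← Finset.sum_add_distrib]
      have : e ^ 2 / 8 * (n : ℝ) = ∑ i ∈ Finset.range n, e ^ 2 / 8 := by simp [mul_comm]
      rw [this, ← Finset.sum_sub_distrib]
      refine Finset.sum_le_sum fun i _ => ?_
      have hlog : ∀ f, Real.log (p f (z i)) =
          Real.log (1 + if f then t (z i) else 0) - Real.log k := fun f =>
        Real.log_div (by have := (abs_le.1 (hft f (z i))).1; linarith) (by linarith)
      cases hf : flag (s i) with
      | true =>
        have h2 := sub_two_mul_sq_le_log (ht2 (z i))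
        have h3 : t (z i) ^ 2 ≤ (e / 4) ^ 2 := sq_le_sq' (abs_le.1 (ht1 _)).1 (abs_le.1 (ht1 _)).2
        simp only [hflag _ hf, if_true, hlog]
        have h4 : t (z i) = e / 4 * (σ * ((if z i = b then 1 else 0) - 1 / (k : ℝ))) := by
          simp only [ht]; ring
        rw [← h4]
        linarith
      | false =>
        have : 0 ≤ e ^ 2 / 8 := by positivity
        cases hty : ty (s i) with
        | true => simp [hlog]; linarith
        | false => simp; linarith
    have h2 : X n ≤ n := by
      have := length_readAt_le z s ty 0 n
      rw [Nat.zero_add] at this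
      simp only [hX]; exact_mod_cast this
    have h3 : e * n ≤ c * n := mul_le_mul_of_nonneg_right (min_le_left _ _) (Nat.cast_nonneg n)
    have h4 := mul_le_mul_of_nonneg_left (h3.trans hn) (by positivity : 0 ≤ e / 4)
    have h5 : Real.log k * g = e ^ 2 / 8 := by rw [hg]; field_simp
    have h6 := mul_le_mul_of_nonneg_left h2 (by positivity : 0 ≤ e ^ 2 / 8)
    have h7 : X n * Real.log k * (1 - g) = X n * Real.log k - e ^ 2 / 8 * X n := by
      rw [← h5]; ring
    have := hM n
    rw [h7]
    linarith
  have hlast : (1 - g) * (1 + Real.log (2 * k) / Real.log T) < 1 := by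
    have h1 : Real.log (2 * k) / Real.log T ≤ g := by
      rw [div_le_iff₀ hlT, mul_comm g]; rwa [div_le_iff₀ hg0] at hT3
    have h2 : 0 < Real.log (2 * k) / Real.log T :=
      div_pos (Real.log_pos (by linarith)) hlT
    nlinarith
  refine (hle.trans (liminf_le_of_frequently_le ?_
    (isBoundedUnder_of_eventually_ge (a := 0) ?_))).trans_lt hlast
  · have hX0 : ∀ᶠ n in atTop, 0 < X n := by
      filter_upwards [tendsto_atTop.1 hxt 1] with n hn
      simp only [hX]; exact_mod_cast hn
    refine (hfreq.and_eventually hX0).mono ?_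
    rintro n ⟨hn, hn0⟩
    have h1 : Real.log ((2 * k : ℕ) * T) = Real.log T * (1 + Real.log (2 * k) / Real.log T) := by
      push_cast
      rw [Real.log_mul (by linarith) (by linarith)]
      field_simp
      ring
    rw [h1, div_le_iff₀ (by positivity)]
    have h3 : 0 ≤ 1 + Real.log (2 * k) / Real.log T := by
      have : 0 ≤ Real.log (2 * k) := Real.log_nonneg (by linarith)
      positivity
    have := mul_le_mul_of_nonneg_right (hM2 n hn) h3
    simp only [hX] at this
    linarith
  · refine Eventually.of_forall fun n => ?_
    have : 0 ≤ Real.log ((2 * k : ℕ) * T) := Real.log_nonneg (by push_cast; nlinarith)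
    exact div_nonneg (mul_nonneg (Nat.cast_nonneg _) this) (mul_nonneg (Nat.cast_nonneg _) hlk.le)

end Gain

/-! ### Normality is a tail property -/

section Shift
variable [Fintype A]

lemma card_words_factor_ge {L i : ℕ} {u : List A} (h : i + u.length ≤ L) [DecidableEq A] :
    Fintype.card A ^ (L - u.length) ≤
      ((words A L).filter fun w => (w.drop i).take u.length = u).card := by
  rw [← card_words]
  refine Finset.card_le_card_of_injOn (fun v => v.take i ++ (u ++ v.drop i)) ?_ ?_
  · intro v hv
    have hv' := mem_words.1 hv
    simp only [Finset.coe_filter, mem_words, Set.mem_ofPred_eq, List.length_append,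
      List.length_take, List.length_drop, hv']
    refine ⟨by omega, ?_⟩
    rw [List.drop_left' (by simp; omega), List.take_left]
  · intro v hv w hw he
    have hv' := mem_words.1 hv
    have hw' := mem_words.1 hw
    obtain ⟨h1, h2⟩ := List.append_inj he (by simp [hv', hw'])
    rw [← List.take_append_drop i v, h1, List.append_cancel_left h2, List.take_append_drop]

omit [Fintype A] in
lemma word_factor (x : ℕ → A) {a L i ℓ : ℕ} (h : i + ℓ ≤ L) :
    ((word x a L).drop i).take ℓ = word x (a + i) ℓ := by
  obtain ⟨m, rfl⟩ := Nat.exists_eq_add_of_le h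
  rw [Nat.add_assoc, word_add, word_add, List.drop_left' (length_word _ _ _),
    List.take_left' (length_word _ _ _)]

omit [Fintype A] in
lemma word_congr {x z : ℕ → A} {a b : ℕ} (h : ∀ n, z (a + n) = x (b + n)) (ℓ : ℕ) :
    word z a ℓ = word x b ℓ :=
  seg_congr ℓ fun i _ => by simp [h]

lemma tendsto_of_forall_eventually_ge {ι : Type*} {s : Finset ι} {f : ι → ℕ → ℝ} {a : ℝ}
    (hsum : ∀ᶠ n in atTop, ∑ i ∈ s, f i n = s.card * a)
    (h : ∀ i ∈ s, ∀ ε > 0, ∀ᶠ n in atTop, a - ε ≤ f i n) {i : ι} (hi : i ∈ s) :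
    Tendsto (f i) atTop (𝓝 a) := by
  classical
  rw [Metric.tendsto_nhds]
  intro ε hε
  have hs : 0 < (s.card : ℝ) := by exact_mod_cast Finset.card_pos.2 ⟨i, hi⟩
  have hall : ∀ᶠ n in atTop, ∀ j ∈ s, a - ε / (2 * s.card) ≤ f j n :=
    (Filter.eventually_all_finset s).2 fun j hj => h j hj _ (by positivity)
  filter_upwards [hsum, hall] with n h1 h2
  have h3 : (1 : ℝ) ≤ s.card := by exact_mod_cast Finset.card_pos.2 ⟨i, hi⟩
  have h4 : ε / (2 * s.card) ≤ ε / 2 :=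
    div_le_div_of_nonneg_left hε.le two_pos (by linarith)
  rw [Real.dist_eq, abs_lt]
  constructor
  · linarith [h2 i hi]
  · have h5 : ∑ j ∈ s.erase i, (a - ε / (2 * s.card)) ≤ ∑ j ∈ s.erase i, f j n :=
      Finset.sum_le_sum fun j hj => h2 j (Finset.mem_of_mem_erase hj)
    rw [Finset.sum_const, Finset.card_erase_of_mem hi, nsmul_eq_mul,
      Nat.cast_sub (Finset.card_pos.2 ⟨i, hi⟩), Nat.cast_one] at h5
    rw [← Finset.add_sum_erase s _ hi] at h1
    have h6 : (s.card - 1) * (ε / (2 * s.card)) ≤ ε / 2 := by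
      rw [← mul_div_assoc, div_le_div_iff₀ (by positivity) two_pos]
      nlinarith
    nlinarith

omit [Fintype A] in
lemma sum_blockCount_le {x z : ℕ → A} {I₀ r ℓ g : ℕ} {u : List A}
    (hz : ∀ n, z (I₀ * ℓ + n) = x (r + n)) (hℓ : 1 ≤ ℓ) (m : ℕ) :
    ∑ j ∈ Finset.range (g - r - 1), blockCount x (g * ℓ)
      (fun w => (w.drop (r + j * ℓ)).take ℓ = u) m ≤ blockCount z ℓ (· = u) (I₀ + m * g) := by
  classical
  unfold blockCount
  rw [← Finset.card_sigma]
  have hpos : ∀ j ∈ Finset.range (g - r - 1), r + j * ℓ + ℓ ≤ g * ℓ := by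
    intro j hj
    have h1 : r ≤ r * ℓ := Nat.le_mul_of_pos_right _ hℓ
    have h2 : (r + j + 1) * ℓ ≤ g * ℓ :=
      Nat.mul_le_mul_right _ (by have := Finset.mem_range.1 hj; omega)
    simp only [Nat.add_mul, Nat.one_mul] at h2
    omega
  refine Finset.card_le_card_of_injOn (fun q => I₀ + (q.2 * g + q.1)) ?_ ?_
  · rintro ⟨j, J⟩ hq
    simp only [Finset.coe_sigma, Set.mem_sigma_iff, Finset.mem_coe, Finset.mem_filter,
      Finset.mem_range] at hq
    obtain ⟨hj, hJ, hw⟩ := hq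
    rw [word_factor _ (hpos j (Finset.mem_range.2 hj))] at hw
    simp only [Finset.coe_filter, Finset.mem_range, Set.mem_ofPred_eq]
    constructor
    · have : (J + 1) * g ≤ m * g := Nat.mul_le_mul_right _ hJ
      rw [Nat.add_mul, Nat.one_mul] at this
      omega
    · rw [← hw]
      refine word_congr (fun n => ?_) ℓ
      rw [show (I₀ + (J * g + j)) * ℓ + n = I₀ * ℓ + (J * (g * ℓ) + j * ℓ + n) by ring, hz]
      congr 1
      ring
  · rintro ⟨j, J⟩ hq ⟨j', J'⟩ hq' he
    simp only [Finset.coe_sigma, Set.mem_sigma_iff, Finset.mem_coe, Finset.mem_filter,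
      Finset.mem_range] at hq hq'
    have hj : j < g := by omega
    have hj' : j' < g := by omega
    have h1 : J * g + j = J' * g + j' := by simpa using he
    have h2 : J = J' := by
      have := congrArg (· / g) h1
      simpa [Nat.mul_add_div (show 0 < g by omega), Nat.mul_comm _ g,
        Nat.div_eq_of_lt hj, Nat.div_eq_of_lt hj'] using this
    subst h2
    obtain rfl : j = j' := by omega
    rfl

omit [Fintype A] in
lemma blockCount_mono (x : ℕ → A) (ℓ : ℕ) (p : List A → Prop) {m n : ℕ} (h : m ≤ n) :
    blockCount x ℓ p m ≤ blockCount x ℓ p n := by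
  classical
  unfold blockCount
  exact Finset.card_le_card (Finset.filter_subset_filter _ (Finset.range_subset_range.2 h))

lemma Normal.of_shift {x z : ℕ → A} (hA : 1 ≤ Fintype.card A) (hx : Normal x) {N M : ℕ}
    (hz : ∀ n, z (N + n) = x (M + n)) : Normal z := by
  classical
  set k := Fintype.card A
  have hk : (0 : ℝ) < k := by exact_mod_cast hA
  refine normal_of_tendsto_blockCount fun ℓ hℓ u hu => ?_
  refine tendsto_of_forall_eventually_ge (s := words A ℓ)
    (f := fun u n => (blockCount z ℓ (· = u) n : ℝ) / n) ?_ ?_ (mem_words.2 hu)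
  · filter_upwards [eventually_gt_atTop 0] with n hn
    have h1 := blockCount_eq_sum z ℓ (fun _ => True) n
    rw [Finset.filter_true] at h1
    rw [← Finset.sum_div, ← Nat.cast_sum, ← h1, card_words, Nat.cast_pow, inv_pow,
      mul_inv_cancel₀ (by positivity)]
    simp only [blockCount, Finset.filter_true, Finset.card_range]
    exact div_self (by positivity)
  clear u hu
  intro u hu ε hε
  rw [mem_words] at hu
  set r := M + (N * ℓ - N)
  have hNℓ : N ≤ N * ℓ := Nat.le_mul_of_pos_right _ hℓ
  have hz' : ∀ n, z (N * ℓ + n) = x (r + n) := fun n => by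
    rw [show N * ℓ + n = N + (N * ℓ - N + n) by omega, hz]
    congr 1
    omega
  obtain ⟨g, hg⟩ := exists_nat_gt ((r + 1 : ℕ) / (ε / 2) + (r + 1 : ℕ))
  have hg1 : ((r + 1 : ℕ) : ℝ) / (ε / 2) < g := by
    have : (0 : ℝ) ≤ (r + 1 : ℕ) := Nat.cast_nonneg _
    linarith
  have hg2 : r + 1 < g := by
    have : (0 : ℝ) ≤ (r + 1 : ℕ) / (ε / 2) := by positivity
    exact_mod_cast (by linarith : ((r + 1 : ℕ) : ℝ) < g)
  have hg0 : (0 : ℝ) < g := by exact_mod_cast (by omega : 0 < g)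
  set a : ℝ := (k : ℝ)⁻¹ ^ ℓ with ha
  have ha0 : 0 ≤ a := by positivity
  have ha1 : a ≤ 1 := pow_le_one₀ (by positivity) (inv_le_one_of_one_le₀ (by exact_mod_cast hA))
  have hlim : ∀ j ∈ Finset.range (g - r - 1), ∃ c, a ≤ c ∧
      Tendsto (fun m => (blockCount x (g * ℓ) (fun w => (w.drop (r + j * ℓ)).take ℓ = u) m : ℝ) / m)
        atTop (𝓝 c) := by
    intro j hj
    refine ⟨_, ?_, hx.tendsto_blockCount (Nat.mul_pos (by omega) hℓ) _⟩
    have h1 : r ≤ r * ℓ := Nat.le_mul_of_pos_right _ hℓ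
    have h2 : (r + j + 1) * ℓ ≤ g * ℓ :=
      Nat.mul_le_mul_right _ (by have := Finset.mem_range.1 hj; omega)
    simp only [Nat.add_mul, Nat.one_mul] at h2
    have h3 : r + j * ℓ + u.length ≤ g * ℓ := by omega
    have h4 := card_words_factor_ge h3
    rw [le_div_iff₀ (by positivity), ha, inv_pow, inv_mul_le_iff₀ (by positivity)]
    have h5 : k ^ (g * ℓ) = k ^ ℓ * k ^ (g * ℓ - ℓ) := by
      rw [← pow_add, Nat.add_sub_cancel' (by omega)]
    simp only [hu] at h4
    calc ((k : ℝ)) ^ (g * ℓ) = ((k ^ ℓ * k ^ (g * ℓ - ℓ) : ℕ) : ℝ) := by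
          rw [← h5]; push_cast; rfl
      _ ≤ _ := by
        push_cast
        refine mul_le_mul_of_nonneg_left ?_ (by positivity)
        exact_mod_cast h4
  choose! c hc1 hc2 using hlim
  have hsum := tendsto_finsetSum _ hc2
  have hclim : (g - (r + 1 : ℕ)) * a ≤ ∑ j ∈ Finset.range (g - r - 1), c j := by
    have := Finset.sum_le_sum hc1
    rw [Finset.sum_const, Finset.card_range, nsmul_eq_mul, Nat.sub_sub,
      Nat.cast_sub hg2.le] at this
    exact this
  have hev := hsum.eventually (lt_mem_nhds (sub_lt_self _ (by positivity : 0 < g * ε / 4)))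
  have hm : Tendsto (fun n => (n - N) / g) atTop atTop :=
    (Nat.tendsto_div_const_atTop (by omega)).comp (tendsto_sub_atTop_nat N)
  have hm2 : Tendsto (fun n : ℕ => (n : ℝ) * (ε / 4)) atTop atTop :=
    tendsto_natCast_atTop_atTop.atTop_mul_const (by positivity)
  filter_upwards [hm.eventually hev, hm.eventually (eventually_gt_atTop 0),
    tendsto_atTop.1 hm2 (N + g), eventually_gt_atTop N] with n h1 h2 h3 h4
  set m := (n - N) / g
  have hn0 : (0 : ℝ) < n := by exact_mod_cast (by omega : 0 < n)
  have hm0 : (0 : ℝ) < m := by exact_mod_cast h2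
  have h5 : N + m * g ≤ n := by
    have : m * g ≤ n - N := Nat.div_mul_le_self (n - N) g
    omega
  have h6 : (n : ℝ) ≤ N + m * g + g := by
    have : n - N < m * g + g := Nat.lt_div_mul_add (a := n - N) (b := g) (by omega)
    exact_mod_cast (by omega : n ≤ N + m * g + g)
  have h7 : blockCount z ℓ (· = u) (N + m * g) ≤ blockCount z ℓ (· = u) n :=
    blockCount_mono z ℓ _ h5
  have h8 := (sum_blockCount_le (g := g) (u := u) hz' hℓ m).trans h7
  have h9 : (∑ j ∈ Finset.range (g - r - 1), (blockCount x (g * ℓ)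
      (fun w => (w.drop (r + j * ℓ)).take ℓ = u) m : ℝ)) ≤ blockCount z ℓ (· = u) n := by
    exact_mod_cast h8
  rw [← Finset.sum_div, lt_div_iff₀ hm0] at h1
  rw [le_div_iff₀ hn0]
  have h10 : ((r + 1 : ℕ) : ℝ) * a ≤ g * (ε / 2) := by
    rw [div_lt_iff₀ (by positivity)] at hg1
    nlinarith [Nat.cast_nonneg (α := ℝ) (r + 1)]
  have h11 : (m * g) * (a - 3 * ε / 4) ≤ (blockCount z ℓ (· = u) n : ℝ) := by
    nlinarith
  rcases le_or_gt a (3 * ε / 4) with h12 | h12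
  · have : (a - ε) * n ≤ 0 := mul_nonpos_of_nonpos_of_nonneg (by linarith) hn0.le
    exact this.trans (Nat.cast_nonneg _)
  · refine le_trans ?_ h11
    have h13 := mul_le_mul_of_nonneg_right (by linarith : (n : ℝ) - N - g ≤ m * g)
      (by linarith : 0 ≤ a - 3 * ε / 4)
    have h14 : ((N : ℝ) + g) * (a - 3 * ε / 4) ≤ N + g :=
      mul_le_of_le_one_right (by positivity) (by linarith)
    nlinarith

end Shift

/-! ### Biased symbols in runs producing words that are not normal -/

section Deviation
variable {K : Type*}

lemma div_mod_block {ℓ i r : ℕ} (hr : r < ℓ) : (i * ℓ + r) / ℓ = i ∧ (i * ℓ + r) % ℓ = r := by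
  rw [Nat.mul_comm, Nat.mul_add_div (by omega), Nat.mul_add_mod, Nat.div_eq_of_lt hr,
    Nat.mod_eq_of_lt hr]
  simp

lemma word_succ (x : ℕ → A) (a n : ℕ) : word x a (n + 1) = word x a n ++ [x (a + n)] := by
  rw [word_add]
  congr 1
  exact seg_one _ _

variable [Fintype A] [DecidableEq A]

lemma sum_block_deviation (z : ℕ → A) {ℓ j : ℕ} {u : List A} (hu : u.length = ℓ) (hj : j < ℓ)
    (n : ℕ) :
    ∑ i ∈ Finset.range (n * ℓ), (if word z (i / ℓ * ℓ) (i % ℓ) = u.take j then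
        (if z i = u[j] then 1 else 0) - 1 / (Fintype.card A : ℝ) else 0) =
      ∑ i ∈ Finset.range n, (if word z (i * ℓ) (j + 1) = u.take (j + 1) then (1 : ℝ) else 0) -
        (∑ i ∈ Finset.range n, if word z (i * ℓ) j = u.take j then (1 : ℝ) else 0) /
          Fintype.card A := by
  induction n with
  | zero => simp
  | succ n ih =>
    rw [Nat.add_mul, Nat.one_mul, Finset.sum_range_add, ih, Finset.sum_range_succ,
      Finset.sum_range_succ, Finset.sum_eq_single (s := Finset.range ℓ) j]
    · obtain ⟨h1, h2⟩ := div_mod_block (i := n) hj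
      have h3 : word z (n * ℓ) (j + 1) = u.take (j + 1) ↔
          word z (n * ℓ) j = u.take j ∧ z (n * ℓ + j) = u[j] := by
        rw [word_succ, List.take_succ_eq_append_getElem (by omega)]
        constructor
        · intro h
          have := List.append_inj' h rfl
          simpa using this
        · rintro ⟨h, h'⟩
          rw [h, h']
      rw [h1, h2]
      by_cases h : word z (n * ℓ) j = u.take j <;> by_cases h' : z (n * ℓ + j) = u[j] <;>
        simp only [h3, h, h', and_true, and_false, if_true, if_false] <;> ring
    · intro r hr hrj
      obtain ⟨h1, h2⟩ := div_mod_block (i := n) (Finset.mem_range.1 hr)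
      rw [h1, h2, if_neg]
      intro h
      have := congrArg List.length h
      simp only [length_word, List.length_take, hu] at this
      omega
    · intro h
      exact absurd (Finset.mem_range.2 hj) h

lemma normal_of_tendsto_deviation {z : ℕ → A}
    (h : ∀ ℓ, 1 ≤ ℓ → ∀ (v : List A) (b : A), Tendsto (fun n : ℕ =>
      (∑ i ∈ Finset.range n, if word z (i / ℓ * ℓ) (i % ℓ) = v then
        (if z i = b then 1 else 0) - 1 / (Fintype.card A : ℝ) else 0) / n) atTop (𝓝 0)) :
    Normal z := by
  classical
  refine normal_of_tendsto_blockCount fun ℓ hℓ u hu => ?_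
  have key : ∀ j ≤ ℓ, Tendsto (fun n : ℕ => (∑ i ∈ Finset.range n,
      if word z (i * ℓ) j = u.take j then (1 : ℝ) else 0) / n) atTop
        (𝓝 ((Fintype.card A : ℝ)⁻¹ ^ j)) := by
    intro j
    induction j with
    | zero =>
      intro _
      refine tendsto_const_nhds.congr' ?_
      filter_upwards [eventually_gt_atTop 0] with n hn
      have : (n : ℝ) ≠ 0 := by positivity
      simp [word, this]
    | succ j ih =>
      intro hj
      have h1 := (h ℓ hℓ (u.take j) (u[j])).comp (tendsto_id.atTop_mul_const' hℓ)
      have h2 := (h1.mul_const (ℓ : ℝ)).add ((ih (by omega)).mul_const (Fintype.card A : ℝ)⁻¹)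
      rw [zero_mul, zero_add, ← pow_succ] at h2
      refine h2.congr fun n => ?_
      simp only [Function.comp, id]
      rw [sum_block_deviation z hu hj]
      push_cast
      have : (ℓ : ℝ) ≠ 0 := by positivity
      field_simp
      ring
  refine (key ℓ le_rfl).congr fun n => ?_
  congr 1
  rw [Finset.sum_boole, blockCount, List.take_of_length_le hu.le]
  congr!

lemma exists_deviation [Finite K] (s : ℕ → K) {z : ℕ → A} (hz : ¬ Normal z) :
    ∃ ℓ, 1 ≤ ℓ ∧ ∃ (v : List A) (b : A) (q : K) (c : ℝ), 0 < c ∧ ∃ᶠ n : ℕ in atTop, c * n ≤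
      |∑ i ∈ Finset.range n, open Classical in
        if s i = q ∧ word z (i / ℓ * ℓ) (i % ℓ) = v then
        (if z i = b then 1 else 0) - 1 / (Fintype.card A : ℝ) else 0| := by
  classical
  have : Fintype K := Fintype.ofFinite K
  by_contra! hcon
  refine hz (normal_of_tendsto_deviation fun ℓ hℓ v b => ?_)
  have h1 : ∀ q : K, Tendsto (fun n : ℕ => (∑ i ∈ Finset.range n,
      if s i = q ∧ word z (i / ℓ * ℓ) (i % ℓ) = v then
        (if z i = b then 1 else 0) - 1 / (Fintype.card A : ℝ) else 0) / n) atTop (𝓝 0) := by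
    intro q
    rw [Metric.tendsto_nhds]
    intro ε hε
    have := hcon ℓ hℓ v b q ε hε
    filter_upwards [this, eventually_gt_atTop 0] with n hn hn0
    have hn0' : (0 : ℝ) < n := by exact_mod_cast hn0
    rw [Real.dist_eq, sub_zero, abs_div, abs_of_pos hn0', div_lt_iff₀ hn0']
    convert hn
  have h2 := tendsto_finsetSum Finset.univ fun q _ => h1 q
  rw [Finset.sum_const_zero] at h2
  refine h2.congr fun n => ?_
  rw [← Finset.sum_div, Finset.sum_comm]
  congr 1
  refine Finset.sum_congr rfl fun i _ => ?_
  by_cases h : word z (i / ℓ * ℓ) (i % ℓ) = v <;> simp [h]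

end Deviation

/-! ### Shufflers as finite-state runs -/

section Shuffler
variable (S : Shuffler A) (x y : ℕ → A)

lemma Shuffler.cfg_eq (n : ℕ) :
    (S.cfg x y (n + 1)).1 = S.δ (S.cfg x y n).1 (S.out x y n) ∧
    (S.cfg x y n).2.1 =
      (seg (readAt (S.out x y) (fun n => (S.cfg x y n).1) S.tyI true) 0 n).length ∧
    (S.cfg x y n).2.2 =
      (seg (readAt (S.out x y) (fun n => (S.cfg x y n).1) S.tyI false) 0 n).length := by
  refine ⟨?_, ?_⟩
  · rw [Shuffler.cfg, Shuffler.out]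
    cases h : S.tyI (S.cfg x y n).1 <;> simp
  · induction n with
    | zero => simp [Shuffler.cfg]
    | succ n ih =>
      rw [seg_succ _ (Nat.zero_le _), seg_succ _ (Nat.zero_le _), List.length_append,
        List.length_append, ← ih.1, ← ih.2, Shuffler.cfg]
      cases h : S.tyI (S.cfg x y n).1 <;> simp [readAt, h]

lemma Shuffler.seg_readAt (n : ℕ) :
    seg (readAt (S.out x y) (fun n => (S.cfg x y n).1) S.tyI true) 0 n = pref x (S.cfg x y n).2.1 ∧
    seg (readAt (S.out x y) (fun n => (S.cfg x y n).1) S.tyI false) 0 n =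
      pref y (S.cfg x y n).2.2 := by
  induction n with
  | zero => simp [Shuffler.cfg, pref_eq_seg]
  | succ n ih =>
    rw [seg_succ _ (Nat.zero_le _), seg_succ _ (Nat.zero_le _), ih.1, ih.2, Shuffler.cfg]
    simp only [pref_eq_seg]
    cases h : S.tyI (S.cfg x y n).1 <;>
      simp [readAt, h, Shuffler.out, seg_succ _ (Nat.zero_le _)]

variable {S x y}

lemma readAt_not {K : Type*} (z : ℕ → A) (s : ℕ → K) (ty : K → Bool) (b : Bool) :
    readAt z s (fun q => !ty q) b = readAt z s ty (!b) := by
  funext t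
  cases h : ty (s t) <;> cases b <;> simp [readAt, h]

variable [Fintype A]

lemma condRho_lt_one_of_not_normal (hA : 2 ≤ Fintype.card A)
    (hx : Tendsto (fun n => (S.cfg x y n).2.1) atTop atTop)
    (hy : Tendsto (fun n => (S.cfg x y n).2.2) atTop atTop) (hz : ¬ Normal (S.out x y)) :
    condRho x y < 1 ∨ condRho y x < 1 := by
  classical
  obtain ⟨ℓ, hℓ, v, b, q, c, hc, hfreq⟩ := exists_deviation (fun n => (S.cfg x y n).1) hz
  set z := S.out x y with hz_def
  let W := {w : List A // w.length < ℓ}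
  have : Finite W := (List.finite_length_lt A ℓ).to_subtype
  let δ' : Fin S.states × W → A → Fin S.states × W := fun p a => (S.δ p.1 a,
    if h : p.2.1.length + 1 < ℓ then ⟨p.2.1 ++ [a], by simpa using h⟩ else ⟨[], hℓ⟩)
  let s' : ℕ → Fin S.states × W := fun n => ((S.cfg x y n).1,
    ⟨word z (n / ℓ * ℓ) (n % ℓ), by rw [length_word]; exact Nat.mod_lt _ hℓ⟩)
  have hs' : ∀ n, s' (n + 1) = δ' (s' n) (z n) := by
    intro n
    refine Prod.ext (S.cfg_eq x y n).1 (Subtype.ext ?_)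
    have hr := Nat.mod_lt n hℓ
    have hn : n / ℓ * ℓ + n % ℓ = n := Nat.div_add_mod' n ℓ
    simp only [s', δ', length_word]
    split_ifs with h
    · obtain ⟨h1, h2⟩ := div_mod_block (i := n / ℓ) h
      rw [← Nat.add_assoc, hn] at h1 h2
      rw [h1, h2, word_succ, hn]
    · have h1 : n + 1 = (n / ℓ + 1) * ℓ + 0 := by
        rw [Nat.add_mul]
        omega
      obtain ⟨h2, h3⟩ := div_mod_block (i := n / ℓ + 1) (r := 0) hℓ
      rw [← h1] at h2 h3
      rw [h3]
      simp [word]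
  have hlen := fun n => (S.cfg_eq x y n).2
  have hpref := fun n => S.seg_readAt x y n
  simp only [(hlen _).1, (hlen _).2, ← hz_def] at hx hy hpref
  let flag : Fin S.states × W → Bool := fun p => decide (p.1 = q ∧ p.2.1 = v)
  have hfreq' : ∃ᶠ n : ℕ in atTop, c * n ≤ |∑ i ∈ Finset.range n,
      if flag (s' i) then (if z i = b then 1 else 0) - 1 / (Fintype.card A : ℝ) else 0| := by
    simp only [flag, s', decide_eq_true_eq]
    convert hfreq
  have hread : ∀ b', readAt z s' (fun p => S.tyI p.1) b' =
      readAt z (fun n => (S.cfg x y n).1) S.tyI b' := fun _ => rfl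
  cases hq : S.tyI q with
  | true =>
    left
    refine condRho_lt_one (s := s') (ty := fun p => S.tyI p.1) hA hs' ?_ ?_ ?_ ?_ flag
      (fun p hp => ?_) b hc hfreq'
    · simpa only [hread] using fun t => (hpref t).1
    · simpa only [hread] using fun t => (hpref t).2
    · simpa only [hread] using hx
    · simpa only [hread] using hy
    · rw [(of_decide_eq_true hp).1, hq]
  | false =>
    right
    have hnot : ∀ b', readAt z s' (fun p => !S.tyI p.1) b' =
      readAt z (fun n => (S.cfg x y n).1) S.tyI (!b') := fun b' =>
        readAt_not z s' (fun p => S.tyI p.1) b'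
    refine condRho_lt_one (s := s') (ty := fun p => !S.tyI p.1) hA hs' ?_ ?_ ?_ ?_ flag
      (fun p hp => ?_) b hc hfreq'
    · simp only [hnot, Bool.not_true]
      exact fun t => (hpref t).2
    · simp only [hnot, Bool.not_false]
      exact fun t => (hpref t).1
    · simp only [hnot, Bool.not_true]
      exact hy
    · simp only [hnot, Bool.not_false]
      exact hx
    · rw [(of_decide_eq_true hp).1, hq]
      rfl

end Shuffler

section Main

/-- The shuffler exchanging the roles of the two inputs. -/
def Shuffler.swap (S : Shuffler A) : Shuffler A :=
  ⟨S.states, S.init, fun q => !S.tyI q, S.δ⟩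

lemma Shuffler.swap_cfg (S : Shuffler A) (x y : ℕ → A) (n : ℕ) :
    S.swap.cfg y x n = ((S.cfg x y n).1, (S.cfg x y n).2.2, (S.cfg x y n).2.1) := by
  induction n with
  | zero => rfl
  | succ n ih =>
    rw [Shuffler.cfg, ih, Shuffler.cfg]
    cases h : S.tyI (S.cfg x y n).1 <;> simp [Shuffler.swap, h]

lemma Shuffler.swap_out (S : Shuffler A) (x y : ℕ → A) : S.swap.out y x = S.out x y := by
  funext n
  rw [Shuffler.out, Shuffler.out, S.swap_cfg]
  cases h : S.tyI (S.cfg x y n).1 <;> simp [Shuffler.swap, h]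

lemma Shuffler.cfg_le_succ (S : Shuffler A) (x y : ℕ → A) (n : ℕ) :
    (S.cfg x y n).2.1 ≤ (S.cfg x y (n + 1)).2.1 := by
  rw [Shuffler.cfg.eq_2]
  cases h : S.tyI (S.cfg x y n).1 <;> simp

lemma Shuffler.cfg_add (S : Shuffler A) (x y : ℕ → A) (n : ℕ) :
    (S.cfg x y n).2.1 + (S.cfg x y n).2.2 = n := by
  rw [(S.cfg_eq x y n).2.1, (S.cfg_eq x y n).2.2]
  simpa using length_readAt_add (S.out x y) (fun n => (S.cfg x y n).1) S.tyI 0 n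

/-- A shuffler reading only finitely many symbols of its first input eventually copies its
second input. -/
lemma Shuffler.exists_shift (S : Shuffler A) (x y : ℕ → A)
    (h : ¬ Tendsto (fun n => (S.cfg x y n).2.1) atTop atTop) :
    ∃ N M, ∀ n, S.out x y (N + n) = y (M + n) := by
  have hmono : Monotone fun n => (S.cfg x y n).2.1 := monotone_nat_of_le_succ (S.cfg_le_succ x y)
  obtain ⟨L, hL⟩ := (tendsto_atTop_of_monotone hmono).resolve_left h
  rw [nhds_discrete, tendsto_pure] at hL
  obtain ⟨N, hN⟩ := eventually_atTop.1 hL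
  refine ⟨N, (S.cfg x y N).2.2, fun n => ?_⟩
  have h1 := hN (N + n) (by omega)
  have h2 := hN (N + n + 1) (by omega)
  have h3 := hN N le_rfl
  have h4 := S.cfg_add x y (N + n)
  have h5 := S.cfg_add x y N
  rw [Shuffler.cfg] at h2
  cases h : S.tyI (S.cfg x y (N + n)).1 with
  | true =>
    simp only [h, if_true] at h2
    omega
  | false =>
    simp only [Shuffler.out, h]
    rw [if_neg (by simp)]
    congr 1
    omega

lemma normal_out_of_condRho_eq_one [Fintype A] (hA : 2 ≤ Fintype.card A) {x y : ℕ → A}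
    (hx : Normal x) (hy : Normal y) (hxy : condRho x y = 1) (hyx : condRho y x = 1)
    (S : Shuffler A) : Normal (S.out x y) := by
  by_cases h1 : Tendsto (fun n => (S.cfg x y n).2.1) atTop atTop
  · by_cases h2 : Tendsto (fun n => (S.cfg x y n).2.2) atTop atTop
    · by_contra hz
      rcases condRho_lt_one_of_not_normal hA h1 h2 hz with h | h
      · exact h.ne hxy
      · exact h.ne hyx
    · obtain ⟨N, M, h⟩ := S.swap.exists_shift y x (by simpa only [S.swap_cfg] using h2)
      rw [S.swap_out] at h
      exact hx.of_shift (by omega) h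
  · obtain ⟨N, M, h⟩ := S.exists_shift x y h1
    exact hy.of_shift (by omega) h

end Main

/-- Two normal words over the same alphabet are finite-state
independent if and only if every shuffling of them by a shuffler is normal. -/
theorem normal_fsIndep_iff_shufflers {A : Type*} [Fintype A]
    (hA : 2 ≤ Fintype.card A) (x y : ℕ → A) (hx : Normal x) (hy : Normal y) :
    FSIndep x y ↔ ∀ S : Shuffler A, Normal (S.out x y) := by
  rw [FSIndep, rho_eq_one hA hx, rho_eq_one hA hy]
  constructor
  · rintro ⟨hxy, hyx, -, -⟩
    exact normal_out_of_condRho_eq_one hA hx hy hxy hyx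
  · intro h
    refine ⟨condRho_eq_one hA h, condRho_eq_one hA fun S => ?_, one_pos, one_pos⟩
    rw [← S.swap_out]
    exact h S.swap

end FSI
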